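/- There exists an absolute constant C₂ > 0 with the following property. Let f(x) = a + b·x^β + c·x^γ be a polynomial with integer coefficients a, b, c and natural number exponents 1 ≤ β < γ, where a ≠ 0, and let s ≥ 1 be a real number with log max(|a|, |b|, |c|, β, γ) ≤ s. If m > 0 is a real number with f′(m) = 0 and f(m) ≠ 0, then |f(m)| ≥ exp(−C₂·s³). -/

import Mathlib

theorem tri_taylor_base (f : ℂ → ℂ) (hf : Differentiable ℂ f) (s : ℂ) (n : ℕ) :
    ∃ g : ℂ → ℂ, Differentiable ℂ g ∧ ∀ z, f z =
      (∑ i ∈ Finset.range n, ((z - s) ^ i / i.factorial) * iteratedDeriv i f s)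
        + (z - s) ^ n * g z := by
  have hh : Differentiable ℂ (fun w => f (w + s)) := by fun_prop
  obtain ⟨F, hF, hFe⟩ := AnalyticAt.exists_eq_sum_add_pow_mul (hh.analyticAt 0) n
  have hFd : Differentiable ℂ F := by
    intro w
    by_cases hw : w = 0
    · subst hw; exact hF.differentiableAt
    · have : F =ᶠ[nhds w] fun z => (f (z + s) - ∑ i ∈ Finset.range n,
          (z ^ i / i.factorial) * iteratedDeriv i (fun w => f (w + s)) 0) / z ^ n := by
        filter_upwards [isOpen_ne.mem_nhds hw] with z hz
        have h1 := hFe z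
        have hz' : z ^ n ≠ 0 := pow_ne_zero _ hz
        simp only [smul_eq_mul] at h1
        rw [eq_div_iff hz', h1]; ring
      refine DifferentiableAt.congr_of_eventuallyEq ?_ this
      have hw' : w ^ n ≠ 0 := pow_ne_zero _ hw
      refine DifferentiableAt.fun_div ?_ (by fun_prop) hw'
      fun_prop
  refine ⟨fun z => F (z - s), by fun_prop, fun z => ?_⟩
  have h1 := hFe (z - s)
  simp only [sub_add_cancel, smul_eq_mul, iteratedDeriv_comp_add_const, zero_add] at h1
  exact h1

theorem tri_neville (f : ℂ → ℂ) (hf : Differentiable ℂ f) (m S : ℕ) (hm : 0 < m) (ε Rp : ℝ)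
    (hε : 0 ≤ ε) (hRp : 1 ≤ Rp) (D : Set ℂ)
    (jets : ∀ q < S, ∀ i < m, ‖iteratedDeriv i f ((2 * q : ℕ) : ℂ)‖ ≤ ε)
    (hD : ∀ z ∈ D, ∀ q < S, ‖z - ((2 * q : ℕ) : ℂ)‖ ≤ Rp) (l : ℕ) :
    ∀ i, i + l < m * S → ∃ N g : ℂ → ℂ, Differentiable ℂ g ∧
      (∀ z, f z = N z + (∏ r ∈ Finset.range (l + 1), (z - ((2 * ((i + r) / m) : ℕ) : ℂ))) * g z) ∧
      ∀ z ∈ D, ‖N z‖ * ∏ k ∈ Finset.range (l + 1), ((max 1 (k / m) : ℕ) : ℝ) ≤ ε * (2 * Rp) ^ l := by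
  induction l with
  | zero =>
    intro i hi
    obtain ⟨g, hg, he⟩ := tri_taylor_base f hf ((2 * (i / m) : ℕ) : ℂ) 1
    refine ⟨fun z => f ((2 * (i / m) : ℕ) : ℂ), g, hg, fun z => ?_, fun z hz => ?_⟩
    · have := he z
      simpa using this
    · have := jets (i / m) (Nat.div_lt_of_lt_mul (by simpa using hi)) 0 hm
      simpa using this
  | succ l ih =>
    intro i hi
    by_cases hc : (i + (l + 1)) / m = i / m
    · obtain ⟨g, hg, he⟩ := tri_taylor_base f hf ((2 * (i / m) : ℕ) : ℂ) (l + 2)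
      have hlm : l + 1 < m := by
        by_contra hcon
        push Not at hcon
        have h1 : (i + m) / m ≤ (i + (l + 1)) / m := Nat.div_le_div_right (by omega)
        rw [Nat.add_div_right _ hm] at h1
        omega
      have hiS : i / m < S := Nat.div_lt_of_lt_mul (by omega)
      refine ⟨fun z => ∑ j ∈ Finset.range (l + 2), ((z - ((2 * (i / m) : ℕ) : ℂ)) ^ j / j.factorial)
          * iteratedDeriv j f ((2 * (i / m) : ℕ) : ℂ), g, hg, fun z => ?_, fun z hz => ?_⟩
      · rw [he z]
        congr 2
        rw [Finset.prod_congr rfl (g := fun _ => (z - ((2 * (i / m) : ℕ) : ℂ)))]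
        · simp
        · intro r hr
          have hr' := Finset.mem_range.1 hr
          have h1 : (i + r) / m ≤ (i + (l + 1)) / m := Nat.div_le_div_right (by omega)
          have h2 : i / m ≤ (i + r) / m := Nat.div_le_div_right (by omega)
          have : (i + r) / m = i / m := by omega
          rw [this]
      · have hp : ∏ k ∈ Finset.range (l + 1 + 1), ((max 1 (k / m) : ℕ) : ℝ) = 1 := by
          apply Finset.prod_eq_one
          intro k hk
          have hk' := Finset.mem_range.1 hk
          rw [Nat.div_eq_of_lt (by omega)]; simp
        rw [hp, mul_one]
        calc _ ≤ ∑ j ∈ Finset.range (l + 2), ε * Rp ^ (l + 1) := by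
              refine (norm_sum_le _ _).trans (Finset.sum_le_sum fun j hj => ?_)
              have hj' := Finset.mem_range.1 hj
              rw [norm_mul, norm_div, norm_pow, mul_comm]
              have h1 := jets _ hiS j (by omega)
              have h2 := hD z hz _ hiS
              have h3 : (1:ℝ) ≤ ‖(j.factorial : ℂ)‖ := by
                simp only [Complex.norm_natCast]; exact_mod_cast Nat.one_le_iff_ne_zero.2 (Nat.factorial_ne_zero j)
              refine mul_le_mul h1 ?_ (by positivity) hε
              calc _ ≤ ‖z - ((2 * (i / m) : ℕ) : ℂ)‖ ^ j := div_le_self (by positivity) h3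
                _ ≤ Rp ^ j := by gcongr
                _ ≤ Rp ^ (l + 1) := pow_le_pow_right₀ hRp (by omega)
          _ = (l + 2 : ℕ) * (ε * Rp ^ (l + 1)) := by simp
          _ ≤ (2 ^ (l + 1) : ℕ) * (ε * Rp ^ (l + 1)) := by
              have : l + 2 ≤ 2 ^ (l + 1) := Nat.lt_two_pow_self
              gcongr
          _ = _ := by push_cast; rw [mul_pow]; ring
    · obtain ⟨N1, g1, hg1, he1, hb1⟩ := ih i (by omega)
      obtain ⟨N2, g2, hg2, he2, hb2⟩ := ih (i + 1) (by omega)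
      set a := i / m with ha
      set b := (i + (l + 1)) / m with hb
      have hab : a ≤ b := Nat.div_le_div_right (by omega)
      have hab' : a < b := by omega
      have hbS : b < S := Nat.div_lt_of_lt_mul hi
      have hd : ((2 * b : ℕ) : ℂ) - ((2 * a : ℕ) : ℂ) ≠ 0 := by
        rw [sub_ne_zero]; exact_mod_cast (by omega : 2 * b ≠ 2 * a)
      refine ⟨fun z => ((z - ((2 * a : ℕ) : ℂ)) * N2 z - (z - ((2 * b : ℕ) : ℂ)) * N1 z) /
        (((2 * b : ℕ) : ℂ) - ((2 * a : ℕ) : ℂ)),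
        fun z => (g2 z - g1 z) / (((2 * b : ℕ) : ℂ) - ((2 * a : ℕ) : ℂ)), by fun_prop,
        fun z => ?_, fun z hz => ?_⟩
      · have e1 := he1 z
        have e2 := he2 z
        have p1 : ∏ r ∈ Finset.range (l + 1 + 1), (z - ((2 * ((i + r) / m) : ℕ) : ℂ)) =
            (∏ r ∈ Finset.range (l + 1), (z - ((2 * ((i + r) / m) : ℕ) : ℂ))) *
              (z - ((2 * b : ℕ) : ℂ)) := by
          rw [Finset.prod_range_succ]
        have p2 : ∏ r ∈ Finset.range (l + 1 + 1), (z - ((2 * ((i + r) / m) : ℕ) : ℂ)) =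
            (z - ((2 * a : ℕ) : ℂ)) *
            (∏ r ∈ Finset.range (l + 1), (z - ((2 * ((i + 1 + r) / m) : ℕ) : ℂ))) := by
          rw [Finset.prod_range_succ', mul_comm]
          congr 1
          refine Finset.prod_congr rfl fun r _ => ?_
          rw [show i + (r + 1) = i + 1 + r by ring]
        set Pz := ∏ r ∈ Finset.range (l + 1 + 1), (z - ((2 * ((i + r) / m) : ℕ) : ℂ))
        have : f z * (((2 * b : ℕ) : ℂ) - ((2 * a : ℕ) : ℂ)) =
          ((z - ((2 * a : ℕ) : ℂ)) * N2 z - (z - ((2 * b : ℕ) : ℂ)) * N1 z) + Pz * (g2 z - g1 z) := by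
          have : f z * (((2 * b : ℕ) : ℂ) - ((2 * a : ℕ) : ℂ)) =
            (z - ((2 * a : ℕ) : ℂ)) * f z - (z - ((2 * b : ℕ) : ℂ)) * f z := by ring
          rw [this]
          nth_rewrite 1 [e2]
          rw [e1, mul_sub Pz]
          nth_rewrite 1 [p2]
          rw [p1]
          ring
        field_simp
        linear_combination this
      · have hd1 : (1:ℝ) ≤ (max 1 ((l+1) / m) : ℕ) := by exact_mod_cast le_max_left _ _
        have hdn : ((max 1 ((l+1) / m) : ℕ) : ℝ) ≤ ‖((2 * b : ℕ) : ℂ) - ((2 * a : ℕ) : ℂ)‖ := by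
          have h1 : ((2 * b : ℕ) : ℂ) - ((2 * a : ℕ) : ℂ) = ((2 * b - 2 * a : ℕ) : ℂ) := by
            rw [Nat.cast_sub (by omega)]
          rw [h1, Complex.norm_natCast]
          have h2 : (i / m) + (l + 1) / m ≤ (i + (l + 1)) / m := Nat.div_add_div_le_add_div
          have : max 1 ((l+1)/m) ≤ 2 * b - 2 * a := by
            apply max_le <;> omega
          exact_mod_cast this
        have hz1 := hD z hz a (by omega)
        have hz2 := hD z hz b hbS
        have hb1 := hb1 z hz
        have hb2 := hb2 z hz
        rw [Finset.prod_range_succ]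
        set Pr := ∏ k ∈ Finset.range (l + 1), ((max 1 (k / m) : ℕ) : ℝ)
        have hPr : 0 ≤ Pr := by positivity
        rw [norm_div]
        set dd := ‖((2 * b : ℕ) : ℂ) - ((2 * a : ℕ) : ℂ)‖
        have hdd : 0 < dd := by linarith
        set X := ‖(z - ((2 * a : ℕ) : ℂ)) * N2 z - (z - ((2 * b : ℕ) : ℂ)) * N1 z‖ with hX
        have hXb : X ≤ Rp * ‖N2 z‖ + Rp * ‖N1 z‖ := by
          refine (norm_sub_le _ _).trans ?_
          rw [norm_mul, norm_mul]
          gcongr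
        calc X / dd * (Pr * ((max 1 ((l+1) / m) : ℕ) : ℝ)) ≤ X / dd * (Pr * dd) := by gcongr
          _ = X * Pr := by field_simp
          _ ≤ (Rp * ‖N2 z‖ + Rp * ‖N1 z‖) * Pr := by gcongr
          _ = Rp * (‖N2 z‖ * Pr) + Rp * (‖N1 z‖ * Pr) := by ring
          _ ≤ Rp * (ε * (2 * Rp) ^ l) + Rp * (ε * (2 * Rp) ^ l) := by gcongr
          _ = _ := by rw [pow_succ]; ring

theorem tri_prod_div (m S : ℕ) (hm : 0 < m) :
    ∏ k ∈ Finset.range (m * (S + 1)), (max 1 (k / m)) = (S.factorial) ^ m := by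
  induction S with
  | zero =>
    simp only [zero_add, mul_one, Nat.factorial_zero, one_pow]
    apply Finset.prod_eq_one
    intro k hk
    rw [Nat.div_eq_of_lt (Finset.mem_range.1 hk)]; simp
  | succ S ih =>
    rw [show m * (S + 1 + 1) = m * (S + 1) + m by ring, Finset.prod_range_add, ih,
      Nat.factorial_succ, mul_pow, mul_comm]
    congr 1
    rw [Finset.prod_congr rfl (g := fun _ => S + 1)]
    · simp
    · intro k hk
      rw [Nat.mul_add_div hm, Nat.div_eq_of_lt (Finset.mem_range.1 hk)]; simp

/-- Schwarz lemma with almost-zeros of multiplicity `m` at `0, 2, ..., 2(S-1)`. -/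
theorem tri_schwarz (f : ℂ → ℂ) (hf : Differentiable ℂ f) (m S : ℕ) (hm : 0 < m) (hS : 0 < S)
    (ε R ρ Mf : ℝ) (hε : 0 ≤ ε) (hR : 4 * S ≤ R) (hMf : 0 ≤ Mf) (hSρ : 2 * S ≤ ρ) (hρR : ρ ≤ R)
    (jets : ∀ q < S, ∀ i < m, ‖iteratedDeriv i f ((2 * q : ℕ) : ℂ)‖ ≤ ε)
    (hM : ∀ z : ℂ, ‖z‖ = R → ‖f z‖ ≤ Mf) (x : ℕ) (hx : (x : ℝ) ≤ ρ) :
    ‖f x‖ ≤ ε * Real.exp ((S + 4 * R) * m) +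
      (Mf + ε * Real.exp ((S + 4 * R) * m)) * (ρ / (R / 2)) ^ (m * S) := by
  have hS1 : (1:ℝ) ≤ S := by exact_mod_cast hS
  have hRpos : 0 < R := by linarith
  obtain ⟨n, hn⟩ : ∃ n, m * S = n + 1 := Nat.exists_eq_succ_of_ne_zero (Nat.mul_pos hm hS).ne'
  have hnode : ∀ q < S, ((2 * q : ℕ) : ℝ) ≤ 2 * S := fun q hq => by
    exact_mod_cast (by omega : 2 * q ≤ 2 * S)
  obtain ⟨N, g, hg, he, hb⟩ := tri_neville f hf m S hm ε (2 * R) hε (by linarith)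
    (Metric.closedBall 0 R) jets (fun z hz q hq => by
      have h1 : ‖z‖ ≤ R := by simpa using hz
      have h2 := hnode q hq
      calc _ ≤ ‖z‖ + ‖((2 * q : ℕ) : ℂ)‖ := norm_sub_le _ _
        _ = ‖z‖ + ((2 * q : ℕ) : ℝ) := by rw [Complex.norm_natCast]
        _ ≤ _ := by linarith) n 0 (by omega)
  simp only [zero_add] at he
  obtain ⟨S', rfl⟩ : ∃ S', S = S' + 1 := Nat.exists_eq_succ_of_ne_zero hS.ne'
  set B := ε * Real.exp (((S' + 1 : ℕ) + 4 * R) * m) with hB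
  have hB0 : 0 ≤ B := by positivity
  have hNb : ∀ z ∈ Metric.closedBall (0:ℂ) R, ‖N z‖ ≤ B := by
    intro z hz
    have h1 := hb z hz
    rw [← hn] at h1
    have h2 : ∏ k ∈ Finset.range (m * (S' + 1)), ((max 1 (k / m) : ℕ) : ℝ) = ((S'.factorial : ℕ) : ℝ) ^ m := by
      rw [← Nat.cast_pow, ← tri_prod_div m S' hm, Nat.cast_prod]
    rw [h2] at h1
    have hF : (0:ℝ) < S'.factorial := by exact_mod_cast Nat.factorial_pos _
    have h3 : (2 * (2 * R)) ^ n ≤ (4 * R) ^ (m * (S' + 1)) := by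
      rw [show 2 * (2 * R) = 4 * R by ring]
      exact pow_le_pow_right₀ (by linarith) (by omega)
    have h4 : (4 * R) ^ (S' + 1) ≤ Real.exp ((S' + 1 : ℕ) + 4 * R) * S'.factorial := by
      have := Real.pow_div_factorial_le_exp (4 * R) (by positivity) (S' + 1)
      rw [div_le_iff₀ (by positivity), Nat.factorial_succ] at this
      have h5 : ((S' + 1 : ℕ) : ℝ) ≤ Real.exp ((S' + 1 : ℕ) : ℝ) := by
        linarith [Real.add_one_le_exp ((S' + 1 : ℕ) : ℝ)]
      calc _ ≤ _ := this
        _ = ((S' + 1 : ℕ) : ℝ) * Real.exp (4 * R) * S'.factorial := by push_cast; ring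
        _ ≤ Real.exp ((S' + 1 : ℕ) : ℝ) * Real.exp (4 * R) * S'.factorial := by gcongr
        _ = _ := by rw [← Real.exp_add]
    have h6 : ‖N z‖ * (S'.factorial : ℝ) ^ m ≤ B * (S'.factorial : ℝ) ^ m := by
      calc _ ≤ ε * (2 * (2 * R)) ^ n := h1
        _ ≤ ε * (4 * R) ^ (m * (S' + 1)) := by gcongr
        _ = ε * ((4 * R) ^ (S' + 1)) ^ m := by rw [← pow_mul, mul_comm m]
        _ ≤ ε * (Real.exp ((S' + 1 : ℕ) + 4 * R) * S'.factorial) ^ m := by gcongr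
        _ = _ := by rw [mul_pow, ← Real.exp_nat_mul, hB, mul_comm (m:ℝ)]; ring
    exact le_of_mul_le_mul_right h6 (by positivity)
  have hg' : ∀ z ∈ closure (Metric.ball (0:ℂ) R), ‖g z‖ ≤ (Mf + B) / (R / 2) ^ (m * (S' + 1)) := by
    intro z hz
    refine Complex.norm_le_of_forall_mem_frontier_norm_le Metric.isBounded_ball
      hg.diffContOnCl ?_ hz
    intro w hw
    rw [frontier_ball _ hRpos.ne'] at hw
    have hw' : ‖w‖ = R := by simpa using hw
    have h1 : ‖f w - N w‖ ≤ Mf + B := (norm_sub_le _ _).trans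
      (add_le_add (hM w hw') (hNb w (by simp [hw'])))
    have h2 : f w - N w = (∏ r ∈ Finset.range (n + 1), (w - ((2 * (r / m) : ℕ) : ℂ))) * g w := by
      rw [he w]; ring
    rw [le_div_iff₀ (by positivity), mul_comm]
    refine le_trans ?_ h1
    rw [h2, norm_mul, norm_prod]
    gcongr
    calc (R / 2) ^ (m * (S' + 1)) = ∏ r ∈ Finset.range (n + 1), (R / 2) := by rw [Finset.prod_const, Finset.card_range, hn]
      _ ≤ _ := by
        refine Finset.prod_le_prod (fun _ _ => by positivity) fun r hr => ?_
        have hr' := Finset.mem_range.1 hr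
        have h3 := hnode (r / m) (Nat.div_lt_of_lt_mul (by omega))
        calc R / 2 ≤ ‖w‖ - ‖((2 * (r / m) : ℕ) : ℂ)‖ := by
              rw [Complex.norm_natCast, hw']; linarith
          _ ≤ _ := norm_sub_norm_le _ _
  have hxball : (x : ℂ) ∈ closure (Metric.ball (0:ℂ) R) := by
    rw [closure_ball _ hRpos.ne']; simp; linarith
  have hx2 : (x : ℂ) ∈ Metric.closedBall (0:ℂ) R := by simp; linarith
  rw [he x]
  refine (norm_add_le _ _).trans (add_le_add (hNb _ hx2) ?_)
  rw [norm_mul, norm_prod]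
  have hpr : ∏ r ∈ Finset.range (n + 1), ‖(x : ℂ) - ((2 * (r / m) : ℕ) : ℂ)‖ ≤ ρ ^ (m * (S' + 1)) := by
    calc _ ≤ ∏ r ∈ Finset.range (n + 1), ρ := by
          refine Finset.prod_le_prod (fun _ _ => norm_nonneg _) fun r hr => ?_
          have hr' := Finset.mem_range.1 hr
          have h3 := hnode (r / m) (Nat.div_lt_of_lt_mul (by omega))
          have : (x : ℂ) - ((2 * (r / m) : ℕ) : ℂ) = (((x : ℝ) - ((2 * (r / m) : ℕ) : ℝ) : ℝ) : ℂ) := by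
            push_cast; ring
          rw [this, Complex.norm_real, Real.norm_eq_abs, abs_le]
          have h0 : (0:ℝ) ≤ x := by positivity
          have h0' : (0:ℝ) ≤ ((2 * (r / m) : ℕ) : ℝ) := by positivity
          constructor <;> linarith
      _ = _ := by rw [Finset.prod_const, Finset.card_range, hn]
  calc _ ≤ ρ ^ (m * (S' + 1)) * ((Mf + B) / (R / 2) ^ (m * (S' + 1))) := by
        refine mul_le_mul hpr (hg' _ hxball) (norm_nonneg _) ?_
        have : 0 ≤ ρ := by linarith
        positivity
    _ = _ := by
        rw [div_pow ρ (R / 2)]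
        generalize (R / 2) ^ (m * (S' + 1)) = q
        ring

open Polynomial in
/-- The binomial polynomial `X choose h` over `ℂ`. -/
noncomputable def triBp (h : ℕ) : Polynomial ℂ := C ((h.factorial : ℂ)⁻¹) * descPochhammer ℂ h

/-- Feldman polynomials. -/
noncomputable def triQ (j k : ℕ) : Polynomial ℂ := triBp j ^ (k / j) * triBp (k % j)

open Polynomial in
/-- Polynomials with integer coefficients, as a subring. -/
noncomputable def triInt : Subring (Polynomial ℂ) := (Polynomial.mapRingHom (Int.castRingHom ℂ)).range

open Polynomial in
theorem tri_bp_succ (h : ℕ) : ((h : ℂ[X]) + 1) * triBp (h + 1) = triBp h * (X - (h : ℂ[X])) := by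
  unfold triBp
  rw [descPochhammer_succ_right, Nat.factorial_succ]
  have : ((h : ℂ[X]) + 1) = C ((h : ℂ) + 1) := by simp
  rw [this, ← mul_assoc, ← C_mul, mul_assoc (C _) (descPochhammer ℂ h)]
  have h1 : (h : ℂ) + 1 ≠ 0 := by exact_mod_cast Nat.succ_ne_zero h
  have h2 : (h.factorial : ℂ) ≠ 0 := by exact_mod_cast Nat.factorial_ne_zero h
  congr 2
  push_cast
  field_simp

open Polynomial in
theorem tri_bp_pascal (h : ℕ) : (triBp (h + 1)).comp (X + 1) = triBp (h + 1) + triBp h := by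
  have h0 := congrArg (fun p => p.comp (X + 1 : ℂ[X])) (descPochhammer_succ_comp_X_sub_one ℂ h)
  simp only [smul_eq_mul, sub_comp, mul_comp, comp_assoc, X_comp, one_comp, add_sub_cancel_right, comp_X, add_comp, natCast_comp] at h0
  have h1 : (h : ℂ) + 1 ≠ 0 := by exact_mod_cast Nat.succ_ne_zero h
  have h2 : (h.factorial : ℂ) ≠ 0 := by exact_mod_cast Nat.factorial_ne_zero h
  unfold triBp
  rw [mul_comp, C_comp]
  have h3 : (descPochhammer ℂ (h+1)).comp (X + 1) = descPochhammer ℂ (h + 1) + (↑h + 1) * descPochhammer ℂ h := by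
    linear_combination -h0
  rw [h3, Nat.factorial_succ, mul_add, ← mul_assoc]
  congr 2
  have : ((h : ℂ[X]) + 1) = C ((h : ℂ) + 1) := by simp
  rw [this, ← C_mul]
  congr 1
  push_cast
  field_simp

open Polynomial in
theorem tri_bp_base (ν : ℕ) (h : ℕ) (hν : ∀ i, 1 ≤ i → i ≤ h → i ∣ ν) :
    ∃ W ∈ triInt, ((h : ℂ[X]) + 1) * (triBp (h + 1)).comp (C (ν : ℂ) * X) = C (ν : ℂ) * X * W := by
  induction h with
  | zero =>
    refine ⟨1, one_mem _, ?_⟩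
    simp [triBp]
  | succ h ih =>
    obtain ⟨W, hW, he⟩ := ih fun i h1 h2 => hν i h1 (by omega)
    obtain ⟨d, hd⟩ := hν (h + 1) (by omega) le_rfl
    refine ⟨W * ((d : ℂ[X]) * X - 1), mul_mem hW (sub_mem (mul_mem (natCast_mem _ _) ⟨X, by simp⟩) (one_mem _)), ?_⟩
    have h2 := congrArg (fun p => p.comp (C (ν : ℂ) * X)) (tri_bp_succ (h + 1))
    simp only [mul_comp, add_comp, natCast_comp, one_comp, sub_comp, X_comp] at h2
    rw [h2]
    have h3 : (C (ν : ℂ) * X - ((h + 1 : ℕ) : ℂ[X])) = ((h : ℂ[X]) + 1) * ((d : ℂ[X]) * X - 1) := by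
      rw [hd]; simp; ring
    rw [h3]
    linear_combination ((d : ℂ[X]) * X - 1) * he

open Polynomial in
theorem tri_bp_int (ν j : ℕ) (hν : ∀ i, 1 ≤ i → i ≤ j → i ∣ ν) (h : ℕ) (hj : h ≤ j) (y : ℕ) :
    (triBp h).comp (C (ν : ℂ) * X + (y : ℂ[X])) ∈ triInt := by
  induction y generalizing h with
  | zero =>
    cases h with
    | zero => simp [triBp, one_mem]
    | succ h =>
      obtain ⟨W, hW, he⟩ := tri_bp_base ν h fun i h1 h2 => hν i h1 (by omega)
      obtain ⟨d, hd⟩ := hν (h + 1) (by omega) hj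
      have hne : ((h : ℂ[X]) + 1) ≠ 0 := by exact_mod_cast Nat.succ_ne_zero h
      have : (triBp (h + 1)).comp (C (ν : ℂ) * X) = (d : ℂ[X]) * X * W := by
        apply mul_left_cancel₀ hne
        rw [he, hd]; simp; ring
      simp only [Nat.cast_zero, add_zero]
      rw [this]
      exact mul_mem (mul_mem (natCast_mem _ _) ⟨X, by simp⟩) hW
  | succ y ih =>
    cases h with
    | zero => simp [triBp, one_mem]
    | succ h =>
      have h2 := congrArg (fun p => p.comp (C (ν : ℂ) * X + (y : ℂ[X]))) (tri_bp_pascal h)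
      simp only [comp_assoc, add_comp, X_comp, one_comp] at h2
      push_cast
      rw [← add_assoc, h2]
      exact add_mem (ih _ hj) (ih _ (by omega))

open Polynomial in
theorem tri_Q_int (ν j : ℕ) (hj : 0 < j) (hν : ∀ i, 1 ≤ i → i ≤ j → i ∣ ν) (k y t : ℕ) :
    ∃ n : ℤ, (ν : ℂ) ^ t * (hasseDeriv t (triQ j k)).eval (y : ℂ) = n := by
  have h1 : (triQ j k).comp (C (ν : ℂ) * X + (y : ℂ[X])) ∈ triInt := by
    unfold triQ
    rw [mul_comp, pow_comp]
    exact mul_mem (pow_mem (tri_bp_int ν j hν j le_rfl y) _)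
      (tri_bp_int ν j hν _ (Nat.mod_lt _ hj).le y)
  obtain ⟨g, hg⟩ := h1
  refine ⟨g.coeff t, ?_⟩
  have h2 : (triQ j k).comp (C (ν : ℂ) * X + (y : ℂ[X])) =
      (taylor (y : ℂ) (triQ j k)).comp (C (ν : ℂ) * X) := by
    rw [taylor_apply, comp_assoc]; simp
  have h3 := congrArg (fun p => p.coeff t) (hg.trans h2)
  simp only [comp_C_mul_X_coeff, taylor_coeff, coe_mapRingHom, coeff_map] at h3
  rw [mul_comm]
  simpa using h3.symm

open Polynomial in
theorem tri_Q_degree (j : ℕ) (k : ℕ) : (triQ j k).degree = k := by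
  have hbp : ∀ h, (triBp h).degree = h := by
    intro h
    unfold triBp
    have h2 : (h.factorial : ℂ)⁻¹ ≠ 0 := inv_ne_zero (by exact_mod_cast Nat.factorial_ne_zero h)
    rw [degree_C_mul h2, degree_eq_natDegree (monic_descPochhammer ℂ h).ne_zero, descPochhammer_natDegree]
  unfold triQ
  rw [degree_mul, degree_pow, hbp, hbp]
  rw [nsmul_eq_mul]
  norm_cast
  rw [mul_comm]
  exact Nat.div_add_mod k j

open Polynomial in
/-- Zero estimate for the polynomial part. -/
theorem tri_zero_poly (j K T : ℕ) (Y : Finset ℕ) (hK : K ≤ T * Y.card) (p : Fin K → ℂ)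
    (hz : ∀ y ∈ Y, ∀ t < T, ∑ k, p k * (hasseDeriv t (triQ j k)).eval (y : ℂ) = 0) : p = 0 := by
  set F : ℂ[X] := ∑ k, p k • triQ j k with hF
  have hdeg : F.degree < K := by
    rw [← mem_degreeLT]
    refine Submodule.sum_mem _ fun k _ => Submodule.smul_mem _ _ ?_
    rw [mem_degreeLT]
    rw [tri_Q_degree]
    exact_mod_cast k.2
  have hF0 : F = 0 := by
    by_contra hne
    have hdiv : ∏ y ∈ Y, (X - C (y : ℂ)) ^ T ∣ F := by
      refine Finset.prod_dvd_of_coprime ?_ ?_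
      · intro a _ b _ hab
        exact (pairwise_coprime_X_sub_C (s := fun n : ℕ => (n : ℂ)) Nat.cast_injective hab).pow
      · intro y hy
        rw [X_sub_C_pow_dvd_iff, ← taylor_apply, X_pow_dvd_iff]
        intro t ht
        rw [taylor_coeff, hF]
        have := hz y hy t ht
        simpa [eval_finsetSum] using this
    have h1 := natDegree_le_of_dvd hdiv hne
    have h2 : (∏ y ∈ Y, (X - C (y : ℂ)) ^ T).natDegree = T * Y.card := by
      rw [natDegree_prod _ _ (fun y _ => pow_ne_zero _ (X_sub_C_ne_zero _))]
      rw [Finset.sum_congr rfl (g := fun _ => T) (fun y _ => by rw [natDegree_pow, natDegree_X_sub_C, mul_one])]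
      rw [Finset.sum_const, smul_eq_mul, mul_comm]
    have h3 := (natDegree_lt_iff_degree_lt hne).2 hdeg
    omega
  have hli := (Polynomial.Sequence.linearIndependent ⟨triQ j, tri_Q_degree j⟩).comp (fun k : Fin K => (k : ℕ)) Fin.val_injective
  rw [Fintype.linearIndependent_iff] at hli
  funext k
  exact hli p hF0 k

open Polynomial in
theorem tri_iteratedDeriv_poly (P : ℂ[X]) (n : ℕ) :
    iteratedDeriv n (fun z => P.eval z) = fun z => (derivative^[n] P).eval z := by
  induction n generalizing P with
  | zero => simp
  | succ n ih =>
    rw [iteratedDeriv_succ']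
    have : deriv (fun z => P.eval z) = fun z => (derivative P).eval z := by
      funext z; exact P.deriv
    rw [this, ih]; rfl

theorem tri_bp_norm (h : ℕ) (w : ℂ) (x : ℝ) (hw : ‖w‖ + h ≤ x) :
    ‖(triBp h).eval w‖ ≤ x ^ h / h.factorial := by
  unfold triBp
  rw [Polynomial.eval_mul, Polynomial.eval_C, descPochhammer_eval_eq_prod_range, norm_mul, norm_inv,
    Complex.norm_natCast, norm_prod, div_eq_inv_mul]
  gcongr
  calc _ ≤ ∏ i ∈ Finset.range h, x := by
        refine Finset.prod_le_prod (fun _ _ => norm_nonneg _) fun i hi => ?_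
        have hi' : (i : ℝ) ≤ h := by exact_mod_cast (Finset.mem_range.1 hi).le
        refine (norm_sub_le _ _).trans ?_
        rw [Complex.norm_natCast]; linarith
    _ = _ := by simp

open Polynomial in
theorem tri_hasse_norm (j : ℕ) (hj : 0 < j) (k : ℕ) (hk : k ≤ 64 * j ^ 3) (t : ℕ) (a : ℝ) (ha : 0 ≤ a)
    (z : ℂ) (hz : ‖z‖ ≤ a * j) :
    ‖(hasseDeriv t (triQ j k)).eval z‖ ≤
      (Real.exp 1 * (a + 2)) ^ (64 * j ^ 3) * Real.exp ((a + 2) * j) := by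
  have hj1 : (1:ℝ) ≤ j := by exact_mod_cast hj
  set M := (Real.exp 1 * (a + 2)) ^ (64 * j ^ 3) * Real.exp ((a + 2) * j) with hM
  have he1 : (1:ℝ) ≤ Real.exp 1 := Real.one_le_exp (by norm_num)
  have hQ : ∀ w : ℂ, ‖w‖ ≤ a * j + 1 → ‖(triQ j k).eval w‖ ≤ M := by
    intro w hw
    unfold triQ
    rw [eval_mul, eval_pow, norm_mul, norm_pow]
    have hx0 : 0 ≤ (a + 2) * (j:ℝ) := by positivity
    have b1 : ‖(triBp j).eval w‖ ≤ (Real.exp 1 * (a + 2)) ^ j := by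
      refine (tri_bp_norm j w ((a + 2) * j) (by nlinarith)).trans ?_
      have := Real.pow_div_factorial_le_exp (j:ℝ) (by positivity) j
      have h1 : Real.exp (j:ℝ) = Real.exp 1 ^ j := by rw [← Real.exp_nat_mul, mul_one]
      rw [mul_pow, mul_pow, ← h1, mul_div_assoc, mul_comm]
      gcongr
    have hjk : ((k % j : ℕ) : ℝ) ≤ j := by exact_mod_cast (Nat.mod_lt _ hj).le
    have b2 : ‖(triBp (k % j)).eval w‖ ≤ Real.exp ((a + 2) * j) :=
      (tri_bp_norm (k % j) w ((a + 2) * j) (by nlinarith)).trans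
        (Real.pow_div_factorial_le_exp _ hx0 _)
    rw [hM]
    refine mul_le_mul ?_ b2 (norm_nonneg _) (by positivity)
    calc _ ≤ ((Real.exp 1 * (a + 2)) ^ j) ^ (k / j) := by gcongr
      _ = (Real.exp 1 * (a + 2)) ^ (j * (k / j)) := by rw [← pow_mul]
      _ ≤ _ := pow_le_pow_right₀ (by nlinarith) ((Nat.mul_div_le k j).trans hk)
  have hc := Complex.norm_iteratedDeriv_le_of_forall_mem_sphere_norm_le (c := z) (R := 1) (C := M)
    (f := fun z => (triQ j k).eval z) t one_pos (Polynomial.differentiable _).diffContOnCl (by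
      intro w hw
      apply hQ
      have : ‖w - z‖ = 1 := by simpa using hw
      have := norm_le_norm_add_norm_sub' w z
      linarith [norm_sub_rev w z])
  rw [tri_iteratedDeriv_poly, one_pow, div_one, ← factorial_smul_hasseDeriv] at hc
  have hf : (0:ℝ) < t.factorial := by exact_mod_cast Nat.factorial_pos t
  have : ‖eval z ((t.factorial • hasseDeriv t) (triQ j k))‖ = t.factorial * ‖eval z (hasseDeriv t (triQ j k))‖ := by
    simp [nsmul_eq_mul]
  rw [this] at hc
  exact le_of_mul_le_mul_left hc hf

theorem tri_lcm (j : ℕ) : ((Nat.lcmUpto j : ℕ) : ℝ) ≤ Real.exp (6 * j) := by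
  have h1 := Chebyshev.psi_eq_log_lcmUpto j
  have h2 := Chebyshev.psi_le_const_mul_self (x := (j:ℝ)) (by positivity)
  have h3 : Real.log 4 ≤ 2 := by
    rw [show (4:ℝ) = 2 * 2 by norm_num, Real.log_mul (by norm_num) (by norm_num)]
    linarith [Real.log_two_lt_d9]
  have h4 : (0:ℝ) < ((Nat.lcmUpto j : ℕ) : ℝ) := by exact_mod_cast Nat.lcmUpto_pos j
  rw [← Real.log_le_iff_le_exp h4, ← h1]
  refine h2.trans ?_
  gcongr
  linarith

theorem tri_lcm_dvd (j i : ℕ) (h1 : 1 ≤ i) (h2 : i ≤ j) : i ∣ Nat.lcmUpto j := by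
  unfold Nat.lcmUpto
  exact Finset.dvd_lcm (f := id) (Finset.mem_Icc.2 ⟨h1, h2⟩)

open Polynomial in
/-- The auxiliary functions. -/
noncomputable def triG {ι : Type} [Fintype ι] (j : ℕ) (p : ι → ℂ) (k : ι → ℕ) (lam : ι → ℂ) (ω : ℂ)
    (t0 t1 : ℕ) (z : ℂ) : ℂ :=
  ∑ i, p i * (hasseDeriv t0 (triQ j (k i))).eval z * lam i ^ t1 * Complex.exp (ω * lam i * z)

open Polynomial in
theorem tri_G_deriv {ι : Type} [Fintype ι] (j : ℕ) (p : ι → ℂ) (k : ι → ℕ) (lam : ι → ℂ) (ω : ℂ)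
    (t0 t1 : ℕ) (z : ℂ) : HasDerivAt (triG j p k lam ω t0 t1)
      (((t0 : ℂ) + 1) * triG j p k lam ω (t0 + 1) t1 z + ω * triG j p k lam ω t0 (t1 + 1) z) z := by
  have h : ∀ i, HasDerivAt (fun z => p i * (hasseDeriv t0 (triQ j (k i))).eval z * lam i ^ t1 *
      Complex.exp (ω * lam i * z))
      (((t0 : ℂ) + 1) * (p i * (hasseDeriv (t0 + 1) (triQ j (k i))).eval z * lam i ^ t1 *
      Complex.exp (ω * lam i * z)) + ω * (p i * (hasseDeriv t0 (triQ j (k i))).eval z * lam i ^ (t1 + 1) *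
      Complex.exp (ω * lam i * z))) z := by
    intro i
    have hd : derivative (hasseDeriv t0 (triQ j (k i))) =
        ((t0 : ℂ[X]) + 1) * hasseDeriv (t0 + 1) (triQ j (k i)) := by
      have := congrArg (fun F => F (triQ j (k i))) (hasseDeriv_comp (R := ℂ) 1 t0)
      simp only [LinearMap.comp_apply, hasseDeriv_one, LinearMap.smul_apply] at this
      rw [this, nsmul_eq_mul, add_comm 1 t0]
      simp
    have h1 := (hasseDeriv t0 (triQ j (k i))).hasDerivAt z
    rw [hd] at h1
    have h2 : HasDerivAt (fun z => Complex.exp (ω * lam i * z)) (Complex.exp (ω * lam i * z) * (ω * lam i * 1)) z :=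
      ((hasDerivAt_id z).const_mul (ω * lam i)).cexp
    refine HasDerivAt.congr_deriv (((h1.const_mul (p i)).mul_const (lam i ^ t1)).mul h2) ?_
    simp only [eval_mul, eval_add, eval_natCast, eval_one]
    ring
  have := HasDerivAt.fun_sum (u := Finset.univ) fun i _ => h i
  unfold triG
  refine HasDerivAt.congr_deriv this ?_
  rw [Finset.mul_sum, Finset.mul_sum, ← Finset.sum_add_distrib]

theorem tri_G_diff {ι : Type} [Fintype ι] (j : ℕ) (p : ι → ℂ) (k : ι → ℕ) (lam : ι → ℂ) (ω : ℂ)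
    (t0 t1 : ℕ) : Differentiable ℂ (triG j p k lam ω t0 t1) :=
  fun z => (tri_G_deriv j p k lam ω t0 t1 z).differentiableAt

theorem tri_G_jets {ι : Type} [Fintype ι] (j : ℕ) (p : ι → ℂ) (k : ι → ℕ) (lam : ι → ℂ) (ω : ℂ)
    (T0 T1 : ℕ) (y : ℂ) (ε : ℝ)
    (h : ∀ a < T0, ∀ b < T1, ‖triG j p k lam ω a b y‖ ≤ ε) (i : ℕ) :
    ∀ t0 t1, t0 + i < T0 → t1 + i < T1 →
      ‖iteratedDeriv i (triG j p k lam ω t0 t1) y‖ ≤ (T0 + ‖ω‖) ^ i * ε := by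
  induction i with
  | zero => intro t0 t1 h0 h1; simpa using h t0 h0 t1 h1
  | succ i ih =>
    intro t0 t1 h0 h1
    rw [iteratedDeriv_succ']
    have hd : deriv (triG j p k lam ω t0 t1) = fun z =>
        ((t0 : ℂ) + 1) * triG j p k lam ω (t0 + 1) t1 z + ω * triG j p k lam ω t0 (t1 + 1) z :=
      funext fun z => (tri_G_deriv j p k lam ω t0 t1 z).deriv
    have hc : ∀ a b, ContDiff ℂ i (triG j p k lam ω a b) := fun a b => (tri_G_diff j p k lam ω a b).contDiff
    rw [hd, iteratedDeriv_fun_add ((contDiff_const.mul (hc _ _)).contDiffAt) ((contDiff_const.mul (hc _ _)).contDiffAt),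
      iteratedDeriv_const_mul_field, iteratedDeriv_const_mul_field]
    have e1 := ih (t0 + 1) t1 (by omega) (by omega)
    have e2 := ih t0 (t1 + 1) (by omega) (by omega)
    have hT : ((t0 : ℝ) + 1) ≤ T0 := by exact_mod_cast (by omega : t0 + 1 ≤ T0)
    have hn : ‖(t0 : ℂ) + 1‖ = (t0 : ℝ) + 1 := by
      rw [show (t0 : ℂ) + 1 = ((t0 + 1 : ℕ) : ℂ) by push_cast; rfl, Complex.norm_natCast]; push_cast; rfl
    refine (norm_add_le _ _).trans ?_
    rw [norm_mul, norm_mul, hn]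
    calc _ ≤ (T0 : ℝ) * ((T0 + ‖ω‖) ^ i * ε) + ‖ω‖ * ((T0 + ‖ω‖) ^ i * ε) := by gcongr
      _ = _ := by rw [pow_succ]; ring

open Polynomial in
theorem tri_vandermonde {κ : Type} [DecidableEq κ] (s : Finset κ) (n : ℕ) (hs : s.card ≤ n) (lam c : κ → ℂ)
    (hinj : Set.InjOn lam s) (h : ∀ t < n, ∑ l ∈ s, c l * lam l ^ t = 0) : ∀ l ∈ s, c l = 0 := by
  intro l hl
  set P : ℂ[X] := ∏ q ∈ s.erase l, (X - C (lam q)) with hP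
  have hdeg : P.natDegree < n := by
    rw [hP, natDegree_prod _ _ (fun q _ => X_sub_C_ne_zero _)]
    simp only [natDegree_X_sub_C, Finset.sum_const, smul_eq_mul, mul_one]
    exact (Finset.card_erase_lt_of_mem hl).trans_le hs
  have h1 : ∑ q ∈ s, c q * P.eval (lam q) = 0 := by
    simp_rw [eval_eq_sum_range' hdeg, Finset.mul_sum]
    rw [Finset.sum_comm]
    refine Finset.sum_eq_zero fun t ht => ?_
    have := h t (Finset.mem_range.1 ht)
    calc _ = P.coeff t * ∑ q ∈ s, c q * lam q ^ t := by
          rw [Finset.mul_sum]; refine Finset.sum_congr rfl fun q _ => by ring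
      _ = 0 := by rw [this, mul_zero]
  rw [Finset.sum_eq_single l] at h1
  · refine (mul_eq_zero.1 h1).resolve_right ?_
    rw [hP, eval_prod]
    refine Finset.prod_ne_zero_iff.2 ?_
    intro q hq
    rw [eval_sub, eval_X, eval_C, sub_ne_zero]
    intro heq
    exact (Finset.ne_of_mem_erase hq) (hinj (Finset.mem_of_mem_erase hq) hl heq.symm)
  · intro q hq hne
    rw [hP, eval_prod, Finset.prod_eq_zero (Finset.mem_erase.2 ⟨hne, hq⟩), mul_zero]
    simp
  · intro hn; exact absurd hl hn


attribute [local instance] Matrix.seminormedAddCommGroup in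
theorem tri_siegel {α β : Type} [Fintype α] [Fintype β] (M : α → β → ℤ) (V : ℝ) (hV : 1 ≤ V)
    (hM : ∀ x y, |(M x y : ℝ)| ≤ V) (h0 : 0 < Fintype.card α)
    (hc : 4 * Fintype.card α ≤ 3 * Fintype.card β) :
    ∃ p : β → ℤ, p ≠ 0 ∧ (∀ x, ∑ y, M x y * p y = 0) ∧
      ∀ y, |(p y : ℝ)| ≤ (Fintype.card β * V) ^ 3 := by
  obtain ⟨t, ht, hmul, hn⟩ := Int.Matrix.exists_ne_zero_int_vec_norm_le (Matrix.of M) (by omega) h0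
  have hb1 : (1:ℝ) ≤ Fintype.card β := by exact_mod_cast (by omega : 1 ≤ Fintype.card β)
  have hA : ‖Matrix.of M‖ ≤ V := by
    rw [Matrix.norm_le_iff (by linarith)]
    intro x y
    rw [Int.norm_eq_abs]; exact hM x y
  have hcr : 4 * (Fintype.card α : ℝ) ≤ 3 * Fintype.card β := by exact_mod_cast hc
  have hapos : (0:ℝ) < Fintype.card α := by exact_mod_cast h0
  refine ⟨t, ht, fun x => by simpa [Matrix.mulVec, dotProduct] using congrFun hmul x, fun y => ?_⟩
  have h1 : ‖t y‖ ≤ ‖t‖ := norm_le_pi_norm t y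
  rw [Int.norm_eq_abs] at h1
  refine h1.trans (hn.trans ?_)
  have hbase : (Fintype.card β : ℝ) * max 1 ‖Matrix.of M‖ ≤ Fintype.card β * V := by
    gcongr
    exact max_le hV hA
  have hb2 : 1 ≤ (Fintype.card β : ℝ) * max 1 ‖Matrix.of M‖ :=
    one_le_mul_of_one_le_of_one_le hb1 (le_max_left _ _)
  calc _ ≤ ((Fintype.card β : ℝ) * max 1 ‖Matrix.of M‖) ^ (3 : ℝ) := by
        refine Real.rpow_le_rpow_of_exponent_le hb2 ?_
        rw [div_le_iff₀ (by linarith)]; linarith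
    _ ≤ (Fintype.card β * V) ^ (3 : ℝ) := by gcongr
    _ = _ := by norm_cast

open Polynomial in
/-- Zero estimate: some late value does not vanish. -/
theorem tri_zero (j : ℕ) (p : Fin (64 * j ^ 3) × Fin (16 * j) × Fin (16 * j) → ℤ)
    (hp : p ≠ 0) (lam : Fin (16 * j) × Fin (16 * j) → ℂ) (hinj : Function.Injective lam)
    (I : Fin (16 * j) × Fin (16 * j) → ℕ → ℂ) (hI : ∀ l y, I l y ≠ 0) :
    ∃ y < 128 * j, Odd y ∧ ∃ t0 < j ^ 2, ∃ t1 < 128 * j ^ 2, ∃ r < 2,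
      ∑ i with i.2.1.1 % 2 = r, (p i : ℂ) * (hasseDeriv t0 (triQ j i.1)).eval (y : ℂ) * lam i.2 ^ t1 * I i.2 y ≠ 0 := by
  by_contra hcon
  push Not at hcon
  apply hp
  have key : ∀ l : Fin (16 * j) × Fin (16 * j), ∀ y < 128 * j, Odd y → ∀ t0 < j ^ 2,
      ∑ k, (p (k, l) : ℂ) * (hasseDeriv t0 (triQ j k)).eval (y : ℂ) = 0 := by
    intro l y hy hodd t0 ht0
    set s : Finset (Fin (16 * j) × Fin (16 * j)) := Finset.univ.filter fun q => q.1.1 % 2 = l.1.1 % 2 with hs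
    have hcard : s.card ≤ 128 * j ^ 2 := by
      have : s.card ≤ (Finset.range (8 * j) ×ˢ Finset.range (16 * j)).card := by
        refine Finset.card_le_card_of_injOn (fun q => (q.1.1 / 2, q.2.1)) ?_ ?_
        · intro q _
          have := q.1.2
          have := q.2.2
          simp only [Finset.coe_product, Set.mem_prod, Finset.mem_coe, Finset.mem_range]
          omega
        · intro q hq q' hq' he
          simp only [hs, Finset.coe_filter, Finset.mem_univ, true_and, Set.mem_ofPred_eq] at hq hq'
          simp only [Prod.mk.injEq] at he
          ext
          · omega
          · omega
      rw [Finset.card_product, Finset.card_range, Finset.card_range] at this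
      calc _ ≤ _ := this
        _ = _ := by ring
    have hv := tri_vandermonde s (128 * j ^ 2) hcard lam
      (fun q => (∑ k, (p (k, q) : ℂ) * (hasseDeriv t0 (triQ j k)).eval (y : ℂ)) * I q y) hinj.injOn (by
        intro t1 ht1
        have := hcon y hy hodd t0 ht0 t1 ht1 (l.1.1 % 2) (Nat.mod_lt _ two_pos)
        refine Eq.trans ?_ this
        rw [hs, Finset.sum_filter, Finset.sum_filter, Fintype.sum_prod_type_right
          (α₁ := Fin (64 * j ^ 3)) (α₂ := Fin (16 * j) × Fin (16 * j))]
        refine Finset.sum_congr rfl fun q _ => ?_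
        dsimp only
        split_ifs
        · rw [Finset.sum_mul, Finset.sum_mul]
          refine Finset.sum_congr rfl fun k _ => by ring
        · simp) l (by simp [hs])
    exact (mul_eq_zero.1 hv).resolve_right (hI l y)
  funext i
  obtain ⟨k, l⟩ := i
  have hY : ((Finset.range (64 * j)).image fun q => 2 * q + 1).card = 64 * j := by
    rw [Finset.card_image_of_injective _ (fun a b h => by simpa using h), Finset.card_range]
  have := tri_zero_poly j (64 * j ^ 3) (j ^ 2) ((Finset.range (64 * j)).image fun q => 2 * q + 1)
    (by rw [hY]; exact le_of_eq (by ring)) (fun k => (p (k, l) : ℂ)) (by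
      intro y hy t ht
      obtain ⟨q, hq, rfl⟩ := Finset.mem_image.1 hy
      have := Finset.mem_range.1 hq
      exact key l _ (by omega) ⟨q, rfl⟩ t ht)
  have h2 := congrFun this k
  simpa using h2

theorem tri_lower (U0 U1 : ℤ) (hU : U0 ≠ 0 ∨ U1 ≠ 0) (P Q : ℕ) (hQ : 1 ≤ Q) (η H : ℝ)
    (hη0 : 0 ≤ η) (hη : η ^ 2 * Q = P) (hirr : Irrational η) (h0 : |(U0 : ℝ)| ≤ H) (h1 : |(U1 : ℝ)| ≤ H) :
    1 ≤ |U0 + U1 * η| * (H * (1 + η) * Q) := by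
  have hne : ∀ U0 U1 : ℤ, (U0 ≠ 0 ∨ U1 ≠ 0) → (U0 : ℝ) + U1 * η ≠ 0 := by
    intro U0 U1 hU h
    by_cases hz : U1 = 0
    · subst hz
      simp only [Int.cast_zero, zero_mul, add_zero, Int.cast_eq_zero] at h
      tauto
    · have hz' : (U1 : ℝ) ≠ 0 := by exact_mod_cast hz
      apply hirr
      refine ⟨-U0 / U1, ?_⟩
      push_cast
      rw [div_eq_iff hz']; linarith
  have n1 := hne U0 U1 hU
  have n2 := hne U0 (-U1) (by simpa using hU)
  have hQ0 : (0:ℝ) < Q := by exact_mod_cast hQ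
  have hint : ((U0 : ℝ) + U1 * η) * (U0 + (-U1 : ℤ) * η) * Q = ((U0 ^ 2 * Q - U1 ^ 2 * P : ℤ) : ℝ) := by
    push_cast; rw [← hη]; ring
  have hz : (U0 ^ 2 * Q - U1 ^ 2 * P : ℤ) ≠ 0 := by
    have : ((U0 ^ 2 * Q - U1 ^ 2 * P : ℤ) : ℝ) ≠ 0 := by
      rw [← hint]; exact mul_ne_zero (mul_ne_zero n1 n2) hQ0.ne'
    exact_mod_cast this
  have h3 : (1:ℝ) ≤ |((U0 ^ 2 * Q - U1 ^ 2 * P : ℤ) : ℝ)| := by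
    rw [← Int.cast_abs]
    exact_mod_cast Int.one_le_abs hz
  rw [← hint, abs_mul, abs_mul, abs_of_pos hQ0] at h3
  refine h3.trans ?_
  rw [mul_assoc]
  gcongr
  refine (abs_add_le _ _).trans ?_
  rw [abs_mul, abs_of_nonneg hη0]
  push_cast
  rw [abs_neg]
  have : |(U1 : ℝ)| * η ≤ H * η := by gcongr
  linarith

theorem tri_pow_exp (x a c : ℝ) (n : ℕ) (hx : 0 ≤ x) (h : x ≤ Real.exp a) (hc : n * a ≤ c) :
    x ^ n ≤ Real.exp c := by
  calc x ^ n ≤ Real.exp a ^ n := by gcongr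
    _ = Real.exp (n * a) := (Real.exp_nat_mul _ _).symm
    _ ≤ _ := Real.exp_le_exp.2 hc

theorem tri_mul_exp {x y a b : ℝ} (hy0 : 0 ≤ y) (h : x ≤ Real.exp a) (h' : y ≤ Real.exp b) :
    x * y ≤ Real.exp (a + b) := by
  rw [Real.exp_add]
  exact mul_le_mul h h' hy0 (Real.exp_pos _).le

theorem tri_nat_exp (j : ℕ) : (j : ℝ) ≤ Real.exp j := by
  linarith [Real.add_one_le_exp (j:ℝ)]

theorem tri_two_exp (n : ℕ) : (2:ℝ) ^ n ≤ Real.exp n :=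
  tri_pow_exp 2 1 n n (by norm_num) (by linarith [Real.add_one_le_exp (1:ℝ)]) (by simp)

theorem tri_lam_bound (j B1 B2 l1 l2 : ℕ) (hj : 1 ≤ j) (σ : ℝ) (hσ : σ ≤ j) (h1 : (B1 : ℝ) ≤ Real.exp σ)
    (h2 : (B2 : ℝ) ≤ Real.exp σ) (hl1 : l1 < 16 * j) (hl2 : l2 < 16 * j) :
    ((l1 * B2 + l2 * B1 : ℕ) : ℝ) ≤ Real.exp (33 * j) := by
  have e := Real.exp_le_exp.2 hσ
  have a1 : (l1 : ℝ) ≤ 16 * j := by exact_mod_cast hl1.le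
  have a2 : (l2 : ℝ) ≤ 16 * j := by exact_mod_cast hl2.le
  have a3 : (32 * j : ℝ) ≤ Real.exp (32 * j) := by linarith [Real.add_one_le_exp (32 * j:ℝ)]
  push_cast
  calc (l1 : ℝ) * B2 + l2 * B1 ≤ 16 * j * Real.exp j + 16 * j * Real.exp j := by
        gcongr <;> linarith
    _ = 32 * j * Real.exp j := by ring
    _ ≤ Real.exp (32 * j) * Real.exp j := by gcongr
    _ = _ := by rw [← Real.exp_add]; ring_nf

theorem tri_lam_pow (j t : ℕ) (x : ℝ) (hx : 0 ≤ x) (h : x ≤ Real.exp (33 * j)) (ht : t ≤ 144 * j ^ 2) :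
    x ^ t ≤ Real.exp (4752 * (j:ℝ) ^ 3) := by
  refine tri_pow_exp x _ _ t hx h ?_
  have : (t : ℝ) ≤ 144 * (j:ℝ) ^ 2 := by exact_mod_cast ht
  calc (t : ℝ) * (33 * j) ≤ (144 * (j:ℝ) ^ 2) * (33 * j) := by gcongr
    _ = _ := by ring

theorem tri_nu_pow (j t : ℕ) (ht : t ≤ 17 * j ^ 2) :
    ((Nat.lcmUpto j : ℕ) : ℝ) ^ t ≤ Real.exp (102 * (j:ℝ) ^ 3) := by
  refine tri_pow_exp _ _ _ t (by positivity) (tri_lcm j) ?_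
  have : (t : ℝ) ≤ 17 * (j:ℝ) ^ 2 := by exact_mod_cast ht
  calc (t : ℝ) * (6 * j) ≤ (17 * (j:ℝ) ^ 2) * (6 * j) := by gcongr
    _ = _ := by ring

theorem tri_j_le (j : ℕ) (hj : 1 ≤ j) : (j:ℝ) ≤ (j:ℝ) ^ 3 := by
  have : (1:ℝ) ≤ j := by exact_mod_cast hj
  exact le_self_pow₀ this (by norm_num)

open Polynomial in
theorem tri_hasse_small (j k t : ℕ) (hj : 1 ≤ j) (hk : k ≤ 64 * j ^ 3) (y : ℕ) (hy : y ≤ 128 * j) :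
    ‖(hasseDeriv t (triQ j k)).eval (y : ℂ)‖ ≤ Real.exp (514 * (j:ℝ) ^ 3) := by
  have h := tri_hasse_norm j hj k hk t 128 (by norm_num) (y : ℂ) (by
    rw [Complex.norm_natCast]; exact_mod_cast hy)
  refine h.trans ?_
  have e5 : (130:ℝ) ≤ Real.exp 5 := by
    have h2 : (2.7:ℝ) ≤ Real.exp 1 := by linarith [Real.exp_one_gt_d9]
    calc (130:ℝ) ≤ 2.7 ^ 5 := by norm_num
      _ ≤ Real.exp 1 ^ 5 := by gcongr
      _ = Real.exp 5 := by rw [← Real.exp_nat_mul]; norm_num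
  have h1 : (Real.exp 1 * (128 + 2)) ^ (64 * j ^ 3) ≤ Real.exp (384 * (j:ℝ) ^ 3) := by
    refine tri_pow_exp _ 6 _ _ (by positivity) ?_ (by push_cast; linarith)
    calc Real.exp 1 * (128 + 2) ≤ Real.exp 1 * Real.exp 5 := by gcongr; linarith
      _ = _ := by rw [← Real.exp_add]; norm_num
  refine (tri_mul_exp (Real.exp_pos _).le h1 le_rfl).trans (Real.exp_le_exp.2 ?_)
  linarith [tri_j_le j hj]

open Polynomial in
theorem tri_hasse_big (j k t : ℕ) (hj : 1 ≤ j) (hk : k ≤ 64 * j ^ 3) (A : ℝ) (hA : A = Real.exp 3000)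
    (hAj : A + 2 ≤ j) (z : ℂ) (hz : ‖z‖ ≤ A * j) :
    ‖(hasseDeriv t (triQ j k)).eval z‖ ≤ Real.exp (192129 * (j:ℝ) ^ 3) := by
  have hA0 : 0 < A := hA ▸ Real.exp_pos _
  have h := tri_hasse_norm j hj k hk t A hA0.le z hz
  refine h.trans ?_
  have hj1 : (1:ℝ) ≤ j := by exact_mod_cast hj
  have hA2 : A + 2 ≤ Real.exp 3001 := by
    have : Real.exp 3001 = A * Real.exp 1 := by rw [hA, ← Real.exp_add]; norm_num
    have h2 : (2:ℝ) ≤ Real.exp 1 := by linarith [Real.exp_one_gt_d9]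
    have h3 : 2 ≤ A := by rw [hA]; linarith [Real.add_one_le_exp (3000:ℝ)]
    rw [this]; nlinarith
  have h1 : (Real.exp 1 * (A + 2)) ^ (64 * j ^ 3) ≤ Real.exp (192128 * (j:ℝ) ^ 3) := by
    refine tri_pow_exp _ 3002 _ _ (by positivity) ?_ (by push_cast; linarith)
    calc Real.exp 1 * (A + 2) ≤ Real.exp 1 * Real.exp 3001 := by gcongr
      _ = _ := by rw [← Real.exp_add]; norm_num
  refine (tri_mul_exp (Real.exp_pos _).le h1 le_rfl).trans (Real.exp_le_exp.2 ?_)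
  have : (A + 2) * (j:ℝ) ≤ (j:ℝ) ^ 3 := by
    calc (A + 2) * (j:ℝ) ≤ j * j := by gcongr
      _ = (j:ℝ) ^ 2 := by ring
      _ ≤ _ := pow_le_pow_right₀ hj1 (by norm_num)
  linarith

/-- The integer monomials. -/
def triI (j P1 Q1 P2 Q2 l1 l2 y : ℕ) : ℕ :=
  P1 ^ (l1 * y / 2) * Q1 ^ (2048 * j ^ 2 - l1 * y / 2) * (P2 ^ (l2 * y) * Q2 ^ (2048 * j ^ 2 - l2 * y))

theorem tri_mix_pow (P Q e E : ℕ) (σ : ℝ) (hP : (P:ℝ) ≤ Real.exp σ) (hQ : (Q:ℝ) ≤ Real.exp σ) (he : e ≤ E) :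
    ((P ^ e * Q ^ (E - e) : ℕ) : ℝ) ≤ Real.exp (E * σ) := by
  push_cast
  have h1 := tri_pow_exp P σ _ e (by positivity) hP le_rfl
  have h2 := tri_pow_exp Q σ _ (E - e) (by positivity) hQ le_rfl
  refine (tri_mul_exp (by positivity) h1 h2).trans (Real.exp_le_exp.2 ?_)
  rw [Nat.cast_sub he]; exact le_of_eq (by ring)

theorem tri_I_le (j P1 Q1 P2 Q2 l1 l2 y : ℕ) (σ : ℝ) (hσ : 4096 * σ ≤ j) (hP1 : (P1:ℝ) ≤ Real.exp σ)
    (hQ1 : (Q1:ℝ) ≤ Real.exp σ) (hP2 : (P2:ℝ) ≤ Real.exp σ) (hQ2 : (Q2:ℝ) ≤ Real.exp σ)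
    (hl1 : l1 < 16 * j) (hl2 : l2 < 16 * j) (hy : y ≤ 128 * j) :
    (triI j P1 Q1 P2 Q2 l1 l2 y : ℝ) ≤ Real.exp ((j:ℝ) ^ 3) := by
  have m1 : l1 * y ≤ 2048 * j ^ 2 := by
    calc l1 * y ≤ (16 * j) * (128 * j) := Nat.mul_le_mul hl1.le hy
      _ = _ := by ring
  have m2 : l2 * y ≤ 2048 * j ^ 2 := by
    calc l2 * y ≤ (16 * j) * (128 * j) := Nat.mul_le_mul hl2.le hy
      _ = _ := by ring
  unfold triI
  rw [Nat.cast_mul]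
  refine (tri_mul_exp (by positivity) (tri_mix_pow P1 Q1 _ _ σ hP1 hQ1 (by omega))
    (tri_mix_pow P2 Q2 _ _ σ hP2 hQ2 m2)).trans (Real.exp_le_exp.2 ?_)
  push_cast
  have : (j:ℝ) ^ 2 * (4096 * σ) ≤ (j:ℝ) ^ 2 * j := by gcongr
  nlinarith

theorem tri_D_le (j Q1 Q2 : ℕ) (σ : ℝ) (hσ : 4096 * σ ≤ j)
    (hQ1 : (Q1:ℝ) ≤ Real.exp σ) (hQ2 : (Q2:ℝ) ≤ Real.exp σ) :
    ((Q1:ℝ) ^ (2048 * j ^ 2) * (Q2:ℝ) ^ (2048 * j ^ 2)) ≤ Real.exp ((j:ℝ) ^ 3) := by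
  refine (tri_mul_exp (by positivity) (tri_pow_exp Q1 σ _ (2048 * j ^ 2) (by positivity) hQ1 le_rfl)
    (tri_pow_exp Q2 σ _ (2048 * j ^ 2) (by positivity) hQ2 le_rfl)).trans (Real.exp_le_exp.2 ?_)
  push_cast
  have : (j:ℝ) ^ 2 * (4096 * σ) ≤ (j:ℝ) ^ 2 * j := by gcongr
  nlinarith

theorem tri_I_eq (j P1 Q1 P2 Q2 l1 l2 y : ℕ) (hP1 : 1 ≤ P1) (hQ1 : 1 ≤ Q1) (hQ2 : 1 ≤ Q2) (η : ℝ)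
    (hη : η ^ 2 * Q1 = P1)
    (hl1 : l1 < 16 * j) (hl2 : l2 < 16 * j) (hy : y ≤ 128 * j) :
    ((Q1:ℝ) ^ (2048 * j ^ 2) * (Q2:ℝ) ^ (2048 * j ^ 2)) * (η ^ (l1 * y) * ((P2:ℝ) / Q2) ^ (l2 * y)) =
      triI j P1 Q1 P2 Q2 l1 l2 y * η ^ ((l1 * y) % 2) := by
  have m1 : l1 * y ≤ 2048 * j ^ 2 := by
    calc l1 * y ≤ (16 * j) * (128 * j) := Nat.mul_le_mul hl1.le hy
      _ = _ := by ring
  have m2 : l2 * y ≤ 2048 * j ^ 2 := by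
    calc l2 * y ≤ (16 * j) * (128 * j) := Nat.mul_le_mul hl2.le hy
      _ = _ := by ring
  have hQ1' : (Q1:ℝ) ≠ 0 := by exact_mod_cast (by omega : Q1 ≠ 0)
  have hQ2' : (Q2:ℝ) ≠ 0 := by exact_mod_cast (by omega : Q2 ≠ 0)
  unfold triI
  set E := 2048 * j ^ 2
  have e1 : η ^ (l1 * y) = (η ^ 2) ^ (l1 * y / 2) * η ^ ((l1 * y) % 2) := by
    rw [← pow_mul, ← pow_add, Nat.div_add_mod]
  have e2 : η ^ 2 = P1 / Q1 := by rw [eq_div_iff hQ1', hη]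
  have e3 : (Q1:ℝ) ^ E = Q1 ^ (l1 * y / 2) * Q1 ^ (E - l1 * y / 2) := by
    rw [← pow_add]; congr 1; omega
  have e4 : (Q2:ℝ) ^ E = Q2 ^ (l2 * y) * Q2 ^ (E - l2 * y) := by
    rw [← pow_add]; congr 1; omega
  rw [e1, e2, e3, e4, div_pow, div_pow]
  push_cast
  field_simp

theorem tri_N_le (j : ℕ) (hj : 1 ≤ j) : ((64 * j ^ 3 * (16 * j * (16 * j)) : ℕ) : ℝ) ≤ Real.exp (19 * (j:ℝ) ^ 3) := by
  have h1 := tri_two_exp 14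
  have h2 := tri_pow_exp (j:ℝ) j _ 5 (by positivity) (tri_nat_exp j) le_rfl
  push_cast at h1 h2 ⊢
  have h3 := tri_mul_exp (by positivity) h1 h2
  have hj1 : (1:ℝ) ≤ (j:ℝ)^3 := one_le_pow₀ (by exact_mod_cast hj)
  calc _ = (2:ℝ) ^ 14 * (j:ℝ) ^ 5 := by ring
    _ ≤ _ := h3
    _ ≤ _ := Real.exp_le_exp.2 (by linarith [tri_j_le j hj])

/-- Index set of the auxiliary function. -/
abbrev triIx (j : ℕ) : Type := Fin (64 * j ^ 3) × Fin (16 * j) × Fin (16 * j)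

/-- Frequencies. -/
def triLam {j : ℕ} (B1 B2 : ℕ) (l : Fin (16 * j) × Fin (16 * j)) : ℕ := l.1.1 * B2 + l.2.1 * B1

/-- The integers `ν ^ t * hasseDeriv t Q_k (y)`. -/
noncomputable def triN (j k y t : ℕ) : ℤ :=
  if h : 0 < j then (tri_Q_int (Nat.lcmUpto j) j h (tri_lcm_dvd j) k y t).choose else 0

open Polynomial in
theorem triN_spec (j k y t : ℕ) (h : 0 < j) :
    ((Nat.lcmUpto j : ℕ) : ℂ) ^ t * (hasseDeriv t (triQ j k)).eval (y : ℂ) = triN j k y t := by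
  unfold triN
  rw [dif_pos h]
  exact (tri_Q_int (Nat.lcmUpto j) j h (tri_lcm_dvd j) k y t).choose_spec

theorem triN_le (j k y t : ℕ) (hj : 1 ≤ j) (hk : k ≤ 64 * j ^ 3) (hy : y ≤ 128 * j)
    (ht : t ≤ 17 * j ^ 2) : |(triN j k y t : ℝ)| ≤ Real.exp (616 * (j:ℝ) ^ 3) := by
  have h := congrArg norm (triN_spec j k y t hj)
  rw [norm_mul, norm_pow, Complex.norm_natCast, Complex.norm_intCast] at h
  rw [← h]
  refine (tri_mul_exp (norm_nonneg _) (tri_nu_pow j t ht) (tri_hasse_small j k t hj hk y hy)).trans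
    (Real.exp_le_exp.2 ?_)
  linarith

/-- Integer matrix entries. -/
noncomputable def triEnt (j P1 Q1 P2 Q2 B1 B2 t0 t1 y : ℕ) (i : triIx j) : ℤ :=
  triN j i.1 y t0 * ((triLam B1 B2 i.2 ^ t1 : ℕ) : ℤ) * (triI j P1 Q1 P2 Q2 i.2.1 i.2.2 y : ℕ)

theorem triEnt_le (j P1 Q1 P2 Q2 B1 B2 t0 t1 y : ℕ) (hj : 1 ≤ j) (i : triIx j) (σ : ℝ) (hσ0 : 0 ≤ σ)
    (hσ : 4096 * σ ≤ j) (hP1 : (P1:ℝ) ≤ Real.exp σ)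
    (hQ1 : (Q1:ℝ) ≤ Real.exp σ) (hP2 : (P2:ℝ) ≤ Real.exp σ) (hQ2 : (Q2:ℝ) ≤ Real.exp σ)
    (hB1 : (B1:ℝ) ≤ Real.exp σ) (hB2 : (B2:ℝ) ≤ Real.exp σ)
    (hy : y ≤ 128 * j) (ht0 : t0 ≤ 17 * j ^ 2) (ht1 : t1 ≤ 144 * j ^ 2) :
    |(triEnt j P1 Q1 P2 Q2 B1 B2 t0 t1 y i : ℝ)| ≤ Real.exp (5369 * (j:ℝ) ^ 3) := by
  unfold triEnt
  push_cast
  rw [abs_mul, abs_mul, abs_of_nonneg (by positivity : (0:ℝ) ≤ (triLam B1 B2 i.2 : ℝ) ^ t1),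
    abs_of_nonneg (by positivity : (0:ℝ) ≤ (triI j P1 Q1 P2 Q2 i.2.1 i.2.2 y : ℝ))]
  refine (tri_mul_exp (by positivity) (tri_mul_exp (by positivity)
    (triN_le j i.1 y t0 hj i.1.2.le hy ht0)
    (tri_lam_pow j t1 _ (by positivity) (tri_lam_bound j B1 B2 i.2.1 i.2.2 hj σ (by linarith) hB1 hB2 i.2.1.2 i.2.2.2) ht1))
    (tri_I_le j P1 Q1 P2 Q2 _ _ y σ hσ hP1 hQ1 hP2 hQ2 i.2.1.2 i.2.2.2 hy)).trans (Real.exp_le_exp.2 ?_)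
  linarith

theorem tri_card (j : ℕ) : Fintype.card (triIx j) = 64 * j ^ 3 * (16 * j * (16 * j)) := by
  simp [triIx]

theorem tri_siegel_stage (j P1 Q1 P2 Q2 B1 B2 : ℕ) (hj : 1 ≤ j) (σ : ℝ) (hσ0 : 0 ≤ σ)
    (hσ : 4096 * σ ≤ j) (hP1 : (P1:ℝ) ≤ Real.exp σ)
    (hQ1 : (Q1:ℝ) ≤ Real.exp σ) (hP2 : (P2:ℝ) ≤ Real.exp σ) (hQ2 : (Q2:ℝ) ≤ Real.exp σ)
    (hB1 : (B1:ℝ) ≤ Real.exp σ) (hB2 : (B2:ℝ) ≤ Real.exp σ) :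
    ∃ p : triIx j → ℤ, p ≠ 0 ∧ (∀ i, |(p i : ℝ)| ≤ Real.exp (16164 * (j:ℝ) ^ 3)) ∧
      ∀ q < 5 * j, ∀ t0 < 17 * j ^ 2, ∀ t1 < 144 * j ^ 2,
        ∑ i, p i * triEnt j P1 Q1 P2 Q2 B1 B2 t0 t1 (2 * q) i = 0 := by
  have hj0 : 0 < j := hj
  obtain ⟨p, hp, hz, hb⟩ := tri_siegel (α := Fin (5 * j) × Fin (17 * j ^ 2) × Fin (144 * j ^ 2)) (β := triIx j)
    (fun x i => triEnt j P1 Q1 P2 Q2 B1 B2 x.2.1 x.2.2 (2 * x.1) i) (Real.exp (5369 * (j:ℝ) ^ 3))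
    (Real.one_le_exp (by positivity))
    (fun x i => triEnt_le j P1 Q1 P2 Q2 B1 B2 _ _ _ hj i σ hσ0 hσ hP1 hQ1 hP2 hQ2 hB1 hB2
      (by have := x.1.2; omega) x.2.1.2.le x.2.2.2.le)
    (by simp only [Fintype.card_prod, Fintype.card_fin]; positivity)
    (by rw [tri_card]
        simp only [Fintype.card_prod, Fintype.card_fin]
        have : 4 * (5 * j * (17 * j ^ 2 * (144 * j ^ 2))) = 48960 * j ^ 5 := by ring
        have h2 : 3 * (64 * j ^ 3 * (16 * j * (16 * j))) = 49152 * j ^ 5 := by ring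
        rw [this, h2]; gcongr; norm_num)
  refine ⟨p, hp, fun i => (hb i).trans ?_, fun q hq t0 ht0 t1 ht1 => ?_⟩
  · rw [tri_card]
    have h1 := tri_mul_exp (Real.exp_pos (5369 * (j:ℝ) ^ 3)).le (tri_N_le j hj) le_rfl
    refine tri_pow_exp _ _ _ 3 (by positivity) h1 (by push_cast; linarith)
  · have := hz (⟨q, hq⟩, ⟨t0, ht0⟩, ⟨t1, ht1⟩)
    rw [← this]
    exact Finset.sum_congr rfl fun i _ => mul_comm _ _

open Polynomial in
/-- The exact value which `triG` approximates. -/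
noncomputable def triX (j : ℕ) (p : triIx j → ℤ) (B1 B2 : ℕ) (η α : ℝ) (t0 t1 y : ℕ) : ℂ :=
  ∑ i : triIx j, (p i : ℂ) * (hasseDeriv t0 (triQ j i.1)).eval (y : ℂ) * (triLam B1 B2 i.2 : ℂ) ^ t1 *
    ((η ^ (i.2.1.1 * y) * α ^ (i.2.2.1 * y) : ℝ) : ℂ)

theorem triX_eq (j P1 Q1 P2 Q2 B1 B2 : ℕ) (hj : 1 ≤ j) (p : triIx j → ℤ) (η : ℝ) (hP1 : 1 ≤ P1) (hQ1 : 1 ≤ Q1) (hQ2 : 1 ≤ Q2)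
    (hη : η ^ 2 * Q1 = P1) (t0 t1 y : ℕ) (hy : y ≤ 128 * j) :
    ((((Nat.lcmUpto j : ℕ) : ℝ) ^ t0 * ((Q1:ℝ) ^ (2048 * j ^ 2) * (Q2:ℝ) ^ (2048 * j ^ 2)) : ℝ) : ℂ) *
      triX j p B1 B2 η ((P2:ℝ) / Q2) t0 t1 y =
    ((∑ i, ((p i * triEnt j P1 Q1 P2 Q2 B1 B2 t0 t1 y i : ℤ) : ℝ) * η ^ ((i.2.1.1 * y) % 2) : ℝ) : ℂ) := by
  unfold triX
  rw [Finset.mul_sum, Complex.ofReal_sum]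
  refine Finset.sum_congr rfl fun i _ => ?_
  have h1 := triN_spec j i.1 y t0 hj
  have h2 := congrArg (fun x : ℝ => (x : ℂ)) (tri_I_eq j P1 Q1 P2 Q2 i.2.1 i.2.2 y hP1 hQ1 hQ2 η hη i.2.1.2 i.2.2.2 hy)
  unfold triEnt
  push_cast at h2 ⊢
  rw [← h1]
  linear_combination ((p i : ℂ) * (((Nat.lcmUpto j : ℕ) : ℂ) ^ t0 * (Polynomial.hasseDeriv t0 (triQ j i.1)).eval (y : ℂ)) *
    (triLam B1 B2 i.2 : ℂ) ^ t1) * h2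

theorem tri_sum_bound (j : ℕ) (hj : 1 ≤ j) {E : Type} [NormedAddCommGroup E] (s : Finset (triIx j)) (F : triIx j → E) (c : ℝ)
    (h : ∀ i, ‖F i‖ ≤ c) (hc : 0 ≤ c) : ‖∑ i ∈ s, F i‖ ≤ Real.exp (19 * (j:ℝ) ^ 3) * c := by
  refine (norm_sum_le _ _).trans ?_
  calc _ ≤ ∑ i ∈ s, c := Finset.sum_le_sum fun i _ => h i
    _ = s.card * c := by simp
    _ ≤ (Fintype.card (triIx j) : ℝ) * c := by gcongr; exact Finset.card_le_univ s
    _ ≤ _ := by rw [tri_card]; gcongr; exact tri_N_le j hj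

theorem tri_late (j P1 Q1 P2 Q2 B1 B2 : ℕ) (hj : 1 ≤ j) (σ : ℝ) (hσ0 : 0 ≤ σ)
    (hσ : 4096 * σ ≤ j) (hP1 : (P1:ℝ) ≤ Real.exp σ)
    (hQ1 : (Q1:ℝ) ≤ Real.exp σ) (hP2 : (P2:ℝ) ≤ Real.exp σ) (hQ2 : (Q2:ℝ) ≤ Real.exp σ)
    (hB1 : (B1:ℝ) ≤ Real.exp σ) (hB2 : (B2:ℝ) ≤ Real.exp σ)
    (p1 : 1 ≤ P1) (q1 : 1 ≤ Q1) (p2 : 1 ≤ P2) (q2 : 1 ≤ Q2)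
    (η : ℝ) (hη0 : 0 ≤ η) (hη : η ^ 2 * Q1 = P1) (hirr : Irrational η)
    (hinj : Function.Injective (triLam (j := j) B1 B2))
    (p : triIx j → ℤ) (hp : p ≠ 0) (hpb : ∀ i, |(p i : ℝ)| ≤ Real.exp (16164 * (j:ℝ) ^ 3)) :
    ∃ y < 128 * j, ∃ t0 < j ^ 2, ∃ t1 < 128 * j ^ 2,
      Real.exp (-21658 * (j:ℝ) ^ 3) ≤ ‖triX j p B1 B2 η ((P2:ℝ) / Q2) t0 t1 y‖ := by
  obtain ⟨y, hy, hodd, t0, ht0, t1, ht1, r, hr, hne⟩ := tri_zero j p hp (fun l => (triLam B1 B2 l : ℂ))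
    (fun a b h => hinj (Nat.cast_injective (R := ℂ) h)) (fun l y => (triI j P1 Q1 P2 Q2 l.1 l.2 y : ℂ))
    (fun l y => by
      have : 0 < triI j P1 Q1 P2 Q2 l.1 l.2 y := by unfold triI; positivity
      exact_mod_cast this.ne')
  refine ⟨y, hy, t0, ht0, t1, ht1, ?_⟩
  set U : ℕ → ℤ := fun r => ∑ i : triIx j with i.2.1.1 % 2 = r, p i * triEnt j P1 Q1 P2 Q2 B1 B2 t0 t1 y i with hU
  have hν : ((Nat.lcmUpto j : ℕ) : ℂ) ^ t0 ≠ 0 := pow_ne_zero _ (by exact_mod_cast (Nat.lcmUpto_pos j).ne')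
  have hUr : U r ≠ 0 := by
    have : ((U r : ℤ) : ℂ) ≠ 0 := by
      rw [hU]
      push_cast
      rw [show (∑ i : triIx j with i.2.1.1 % 2 = r, (p i : ℂ) * (triEnt j P1 Q1 P2 Q2 B1 B2 t0 t1 y i : ℂ)) =
        ((Nat.lcmUpto j : ℕ) : ℂ) ^ t0 * _ from ?_]
      · exact mul_ne_zero hν hne
      · rw [Finset.mul_sum]
        refine Finset.sum_congr rfl fun i _ => ?_
        unfold triEnt
        push_cast
        rw [← triN_spec j i.1 y t0 hj]
        ring
    exact_mod_cast this
  have hU01 : U 0 ≠ 0 ∨ U 1 ≠ 0 := by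
    interval_cases r <;> tauto
  have hUb : ∀ r, |(U r : ℝ)| ≤ Real.exp (21552 * (j:ℝ) ^ 3) := by
    intro r
    rw [hU]
    push_cast
    rw [← Real.norm_eq_abs]
    have h1 : ∀ i : triIx j, ‖(p i : ℝ) * (triEnt j P1 Q1 P2 Q2 B1 B2 t0 t1 y i : ℝ)‖ ≤ Real.exp (16164 * (j:ℝ) ^ 3 + 5369 * (j:ℝ) ^ 3) := by
      intro i
      rw [norm_mul]
      refine tri_mul_exp (norm_nonneg _) (hpb i) ?_
      have a1 : j ^ 2 ≤ 17 * j ^ 2 := by omega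
      exact triEnt_le j P1 Q1 P2 Q2 B1 B2 t0 t1 y hj i σ hσ0 hσ hP1 hQ1 hP2 hQ2 hB1 hB2 hy.le (by omega) (by omega)
    refine (tri_sum_bound j hj _ _ _ h1 (Real.exp_pos _).le).trans ?_
    rw [← Real.exp_add]
    exact Real.exp_le_exp.2 (by linarith)
  have hlow := tri_lower (U 0) (U 1) hU01 P1 Q1 q1 η _ hη0 hη hirr (hUb 0) (hUb 1)
  have hXe := triX_eq j P1 Q1 P2 Q2 B1 B2 hj p η p1 q1 q2 hη t0 t1 y hy.le
  have hVal : (∑ i : triIx j, ((p i * triEnt j P1 Q1 P2 Q2 B1 B2 t0 t1 y i : ℤ) : ℝ) * η ^ ((i.2.1.1 * y) % 2)) = U 0 + U 1 * η := by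
    rw [hU]
    push_cast
    rw [Finset.sum_mul, Finset.sum_filter, Finset.sum_filter, ← Finset.sum_add_distrib]
    refine Finset.sum_congr rfl fun i _ => ?_
    have hm : (i.2.1.1 * y) % 2 = i.2.1.1 % 2 := by
      rw [Nat.mul_mod, Nat.odd_iff.1 hodd, mul_one, Nat.mod_mod]
    rw [hm]
    rcases Nat.mod_two_eq_zero_or_one i.2.1.1 with h | h <;> simp [h]
  rw [hVal] at hXe
  have hn := congrArg norm hXe
  rw [norm_mul, Complex.norm_real, Complex.norm_real, Real.norm_eq_abs, Real.norm_eq_abs,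
    abs_of_nonneg (by positivity : (0:ℝ) ≤ ((Nat.lcmUpto j : ℕ) : ℝ) ^ t0 * ((Q1:ℝ) ^ (2048 * j ^ 2) * (Q2:ℝ) ^ (2048 * j ^ 2)))] at hn
  have a1 : j ^ 2 ≤ 17 * j ^ 2 := by omega
  have hνD := tri_mul_exp (by positivity) (tri_nu_pow j t0 (by omega)) (tri_D_le j Q1 Q2 σ hσ hQ1 hQ2)
  have hj1 : (1:ℝ) ≤ (j:ℝ)^3 := one_le_pow₀ (by exact_mod_cast hj)
  have hη1 : 1 + η ≤ Real.exp (σ + 1) := by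
    have e1 : 1 ≤ Real.exp σ := Real.one_le_exp hσ0
    have e2 : η ≤ Real.exp σ := by
      by_contra hc
      push Not at hc
      have h3 : (1:ℝ) ≤ Q1 := by exact_mod_cast q1
      have h4 : η ^ 2 ≤ P1 := by rw [← hη]; exact le_mul_of_one_le_right (by positivity) h3
      nlinarith
    have e3 : 2 ≤ Real.exp 1 := by linarith [Real.exp_one_gt_d9]
    rw [Real.exp_add]; nlinarith
  have hH : Real.exp (21552 * (j:ℝ) ^ 3) * (1 + η) * Q1 ≤ Real.exp (21555 * (j:ℝ) ^ 3) := by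
    refine (tri_mul_exp (by positivity) (tri_mul_exp (by positivity) le_rfl hη1) hQ1).trans (Real.exp_le_exp.2 ?_)
    linarith [tri_j_le j hj]
  have hfin : 1 ≤ ‖triX j p B1 B2 η ((P2:ℝ) / Q2) t0 t1 y‖ * Real.exp (21658 * (j:ℝ) ^ 3) := by
    refine hlow.trans ?_
    rw [← hn]
    calc _ ≤ (Real.exp (102 * (j:ℝ) ^ 3 + (j:ℝ) ^ 3) * ‖triX j p B1 B2 η ((P2:ℝ) / Q2) t0 t1 y‖) * Real.exp (21555 * (j:ℝ) ^ 3) := by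
          gcongr
      _ = ‖triX j p B1 B2 η ((P2:ℝ) / Q2) t0 t1 y‖ * (Real.exp (102 * (j:ℝ) ^ 3 + (j:ℝ) ^ 3) * Real.exp (21555 * (j:ℝ) ^ 3)) := by ring
      _ = _ := by rw [← Real.exp_add]; ring_nf
  rw [neg_mul, Real.exp_neg]
  exact (inv_le_iff_one_le_mul₀ (Real.exp_pos _)).2 hfin

theorem tri_log_le (P : ℕ) (hP : 1 ≤ P) (σ : ℝ) (h : (P:ℝ) ≤ Real.exp σ) : 0 ≤ Real.log P ∧ Real.log P ≤ σ := by
  have : (1:ℝ) ≤ P := by exact_mod_cast hP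
  exact ⟨Real.log_nonneg this, (Real.log_le_iff_le_exp (by linarith)).2 h⟩

theorem tri_angle (j P1 Q1 P2 Q2 B1 B2 : ℕ) (σ : ℝ) (hσ1 : 1 ≤ σ) (hP1 : (P1:ℝ) ≤ Real.exp σ)
    (hQ1 : (Q1:ℝ) ≤ Real.exp σ) (hP2 : (P2:ℝ) ≤ Real.exp σ) (hQ2 : (Q2:ℝ) ≤ Real.exp σ)
    (p1 : 1 ≤ P1) (q1 : 1 ≤ Q1) (p2 : 1 ≤ P2) (q2 : 1 ≤ Q2) (b2 : 1 ≤ B2)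
    (η : ℝ) (hη0 : 0 < η) (hη : η ^ 2 * Q1 = P1)
    (hΛ : |B2 * Real.log (P2 / Q2) - B1 * Real.log η| ≤ 1) :
    |Real.log η / B2| ≤ σ ∧ ∀ l : Fin (16 * j) × Fin (16 * j), |Real.log η / B2 * triLam B1 B2 l| ≤ 48 * j * σ := by
  have hB2 : (1:ℝ) ≤ B2 := by exact_mod_cast b2
  have hQ1' : (Q1:ℝ) ≠ 0 := by exact_mod_cast (by omega : Q1 ≠ 0)
  have hQ2' : (Q2:ℝ) ≠ 0 := by exact_mod_cast (by omega : Q2 ≠ 0)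
  have hP2' : (P2:ℝ) ≠ 0 := by exact_mod_cast (by omega : P2 ≠ 0)
  have h1 : 2 * Real.log η = Real.log P1 - Real.log Q1 := by
    rw [← hη, Real.log_mul (by positivity) hQ1', Real.log_pow]; push_cast; ring
  have a1 := tri_log_le P1 p1 σ hP1
  have a2 := tri_log_le Q1 q1 σ hQ1
  have a3 := tri_log_le P2 p2 σ hP2
  have a4 := tri_log_le Q2 q2 σ hQ2
  have hlη : |Real.log η| ≤ σ := by rw [abs_le]; constructor <;> linarith
  rw [Real.log_div hP2' hQ2'] at hΛ
  have hB : |B1 * Real.log η / B2| ≤ 2 * σ := by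
    have e : B1 * Real.log η / B2 = (Real.log P2 - Real.log Q2) - (B2 * (Real.log P2 - Real.log Q2) - B1 * Real.log η) / B2 := by
      field_simp; ring
    have e1 : |Real.log P2 - Real.log Q2| ≤ σ := by rw [abs_le]; constructor <;> linarith
    have e2 : |(B2 * (Real.log P2 - Real.log Q2) - B1 * Real.log η) / B2| ≤ 1 := by
      rw [abs_div, abs_of_pos (by linarith : (0:ℝ) < B2)]
      exact (div_le_one (by linarith)).2 (hΛ.trans hB2)
    rw [e]
    refine (abs_sub _ _).trans ?_
    linarith
  refine ⟨?_, fun l => ?_⟩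
  · rw [abs_div, abs_of_pos (by linarith : (0:ℝ) < B2)]
    exact (div_le_self (abs_nonneg _) hB2).trans hlη
  · have hl1 : (l.1.1 : ℝ) ≤ 16 * j := by exact_mod_cast l.1.2.le
    have hl2 : (l.2.1 : ℝ) ≤ 16 * j := by exact_mod_cast l.2.2.le
    have e : Real.log η / B2 * triLam B1 B2 l = l.1.1 * Real.log η + l.2.1 * (B1 * Real.log η / B2) := by
      unfold triLam; push_cast; field_simp
    rw [e]
    refine (abs_add_le _ _).trans ?_
    rw [abs_mul, abs_mul, Nat.abs_cast, Nat.abs_cast]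
    calc _ ≤ 16 * j * σ + 16 * j * (2 * σ) := by gcongr
      _ = _ := by ring

theorem tri_approx (j P1 Q1 P2 Q2 B1 B2 : ℕ) (hj : 1 ≤ j) (σ : ℝ) (hσ1 : 1 ≤ σ)
    (hσ : 4096 * σ ≤ j) (hP1 : (P1:ℝ) ≤ Real.exp σ)
    (hQ1 : (Q1:ℝ) ≤ Real.exp σ) (hP2 : (P2:ℝ) ≤ Real.exp σ) (hQ2 : (Q2:ℝ) ≤ Real.exp σ)
    (hB1 : (B1:ℝ) ≤ Real.exp σ) (hB2 : (B2:ℝ) ≤ Real.exp σ)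
    (p1 : 1 ≤ P1) (q1 : 1 ≤ Q1) (p2 : 1 ≤ P2) (q2 : 1 ≤ Q2) (b2 : 1 ≤ B2)
    (η : ℝ) (hη0 : 0 < η) (hη : η ^ 2 * Q1 = P1) (Λ : ℝ)
    (hΛe : Λ = B2 * Real.log (P2 / Q2) - B1 * Real.log η)
    (hΛ : |Λ| ≤ Real.exp (-100000 * (j:ℝ) ^ 3))
    (p : triIx j → ℤ) (hpb : ∀ i, |(p i : ℝ)| ≤ Real.exp (16164 * (j:ℝ) ^ 3))
    (t0 t1 y : ℕ) (ht1 : t1 ≤ 144 * j ^ 2) (hy : y ≤ 128 * j) :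
    ‖triG j (fun i => (p i : ℂ)) (fun i => i.1.1) (fun i => (triLam B1 B2 i.2 : ℂ)) ((Real.log η / B2 : ℝ) : ℂ) t0 t1 y -
      triX j p B1 B2 η ((P2:ℝ) / Q2) t0 t1 y‖ ≤ |Λ| * Real.exp (23000 * (j:ℝ) ^ 3) := by
  have hj1 : (1:ℝ) ≤ j := by exact_mod_cast hj
  have hu1 : (1:ℝ) ≤ (j:ℝ)^3 := one_le_pow₀ hj1
  have hΛ1 : |Λ| ≤ 1 := hΛ.trans (Real.exp_le_one_iff.2 (by linarith))
  obtain ⟨-, hang⟩ := tri_angle j P1 Q1 P2 Q2 B1 B2 σ hσ1 hP1 hQ1 hP2 hQ2 p1 q1 p2 q2 b2 η hη0 hη (hΛe ▸ hΛ1)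
  have hB2' : (1:ℝ) ≤ B2 := by exact_mod_cast b2
  have hα : (0:ℝ) < (P2:ℝ) / Q2 := by
    have : (0:ℝ) < P2 := by exact_mod_cast p2
    have : (0:ℝ) < Q2 := by exact_mod_cast q2
    positivity
  have h4096 : 4096 * (j:ℝ) ^ 2 ≤ Real.exp (14 * (j:ℝ) ^ 3) := by
    have h1 := tri_two_exp 12
    have h2 := tri_pow_exp (j:ℝ) j _ 2 (by positivity) (tri_nat_exp j) le_rfl
    push_cast at h1 h2
    have h3 := tri_mul_exp (by positivity) h1 h2
    calc 4096 * (j:ℝ) ^ 2 = 2 ^ 12 * (j:ℝ) ^ 2 := by norm_num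
      _ ≤ _ := h3
      _ ≤ _ := Real.exp_le_exp.2 (by linarith [tri_j_le j hj])
  have hδ1 : 2048 * (j:ℝ) ^ 2 * |Λ| ≤ 1 := by
    calc 2048 * (j:ℝ) ^ 2 * |Λ| ≤ Real.exp (14 * (j:ℝ) ^ 3) * Real.exp (-100000 * (j:ℝ) ^ 3) := by
          gcongr; linarith [sq_nonneg (j:ℝ)]
      _ = Real.exp (14 * (j:ℝ) ^ 3 + -100000 * (j:ℝ) ^ 3) := by rw [Real.exp_add]
      _ ≤ 1 := Real.exp_le_one_iff.2 (by linarith)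
  unfold triG triX
  rw [← Finset.sum_sub_distrib]
  have hterm : ∀ i : triIx j, ‖(p i : ℂ) * (Polynomial.hasseDeriv t0 (triQ j i.1)).eval (y : ℂ) * (triLam B1 B2 i.2 : ℂ) ^ t1 *
      Complex.exp (((Real.log η / B2 : ℝ) : ℂ) * (triLam B1 B2 i.2 : ℂ) * y) -
      (p i : ℂ) * (Polynomial.hasseDeriv t0 (triQ j i.1)).eval (y : ℂ) * (triLam B1 B2 i.2 : ℂ) ^ t1 *
      ((η ^ (i.2.1.1 * y) * ((P2:ℝ) / Q2) ^ (i.2.2.1 * y) : ℝ) : ℂ)‖ ≤ |Λ| * Real.exp (21446 * (j:ℝ) ^ 3) := by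
    intro i
    rw [← mul_sub, norm_mul, norm_mul, norm_mul, norm_pow, Complex.norm_intCast, Complex.norm_natCast]
    have hl2 : (i.2.2.1 : ℝ) ≤ 16 * j := by exact_mod_cast i.2.2.2.le
    have hy' : (y : ℝ) ≤ 128 * j := by exact_mod_cast hy
    set θ : ℝ := Real.log η / B2 * triLam B1 B2 i.2 with hθ
    set δ : ℝ := i.2.2.1 * y * (Λ / B2) with hδ
    have hδb : |δ| ≤ 2048 * (j:ℝ) ^ 2 * |Λ| := by
      rw [hδ, abs_mul, abs_of_nonneg (by positivity), abs_div, abs_of_pos (by linarith : (0:ℝ) < B2)]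
      calc _ ≤ (16 * j) * (128 * j) * |Λ| := by
            gcongr
            exact div_le_self (abs_nonneg _) hB2'
        _ = _ := by ring
    have hexp : η ^ (i.2.1.1 * y) * ((P2:ℝ) / Q2) ^ (i.2.2.1 * y) = Real.exp (θ * y) * Real.exp δ := by
      rw [← Real.exp_add]
      nth_rewrite 1 [← Real.exp_log hη0]
      nth_rewrite 1 [← Real.exp_log hα]
      rw [← Real.exp_nat_mul, ← Real.exp_nat_mul, ← Real.exp_add]
      congr 1
      rw [hθ, hδ, hΛe]
      unfold triLam
      push_cast
      field_simp
      ring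
    have hc : Complex.exp (((Real.log η / B2 : ℝ) : ℂ) * (triLam B1 B2 i.2 : ℂ) * y) = ((Real.exp (θ * y) : ℝ) : ℂ) := by
      rw [hθ]; push_cast; rfl
    rw [hc, hexp, ← Complex.ofReal_sub, Complex.norm_real, Real.norm_eq_abs]
    have hlast : |Real.exp (θ * y) - Real.exp (θ * y) * Real.exp δ| ≤ Real.exp (16 * (j:ℝ) ^ 3) * |Λ| := by
      have e1 : Real.exp (θ * y) - Real.exp (θ * y) * Real.exp δ = - (Real.exp (θ * y) * (Real.exp δ - 1)) := by ring
      have e2 : |Real.exp δ - 1| ≤ 2 * |δ| := Real.abs_exp_sub_one_le (hδb.trans hδ1)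
      have e3 : Real.exp (θ * y) ≤ Real.exp (2 * (j:ℝ) ^ 3) := by
        refine Real.exp_le_exp.2 ?_
        have := hang i.2
        calc θ * y ≤ |θ| * y := by gcongr; exact le_abs_self _
          _ ≤ (48 * j * σ) * (128 * j) := by gcongr
          _ = (j:ℝ) ^ 2 * (6144 * σ) := by ring
          _ ≤ (j:ℝ) ^ 2 * (2 * j) := mul_le_mul_of_nonneg_left (by linarith) (by positivity)
          _ = _ := by ring
      rw [e1, abs_neg, abs_mul, abs_of_pos (Real.exp_pos _)]
      calc _ ≤ Real.exp (2 * (j:ℝ) ^ 3) * (2 * (2048 * (j:ℝ) ^ 2 * |Λ|)) := by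
            gcongr; linarith
        _ = Real.exp (2 * (j:ℝ) ^ 3) * (4096 * (j:ℝ) ^ 2) * |Λ| := by ring
        _ ≤ Real.exp (2 * (j:ℝ) ^ 3) * Real.exp (14 * (j:ℝ) ^ 3) * |Λ| := by gcongr
        _ = _ := by rw [← Real.exp_add]; ring_nf
    have hfirst := tri_mul_exp (by positivity) (tri_mul_exp (norm_nonneg _) (hpb i) (tri_hasse_small j i.1 t0 hj i.1.2.le y hy))
      (tri_lam_pow j t1 _ (by positivity) (tri_lam_bound j B1 B2 i.2.1 i.2.2 hj σ (by linarith) hB1 hB2 i.2.1.2 i.2.2.2) ht1)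
    calc _ ≤ Real.exp (16164 * (j:ℝ) ^ 3 + 514 * (j:ℝ) ^ 3 + 4752 * (j:ℝ) ^ 3) * (Real.exp (16 * (j:ℝ) ^ 3) * |Λ|) :=
          mul_le_mul hfirst hlast (abs_nonneg _) (Real.exp_pos _).le
      _ = |Λ| * (Real.exp (16164 * (j:ℝ) ^ 3 + 514 * (j:ℝ) ^ 3 + 4752 * (j:ℝ) ^ 3) * Real.exp (16 * (j:ℝ) ^ 3)) := by ring
      _ = _ := by rw [← Real.exp_add]; ring_nf
  refine (tri_sum_bound j hj _ _ _ hterm (by positivity)).trans ?_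
  rw [mul_left_comm, ← Real.exp_add]
  gcongr
  linarith

theorem tri_G_big (j B1 B2 : ℕ) (hj : 1 ≤ j) (σ : ℝ) (hσ1 : 1 ≤ σ) (hσ : 4096 * σ ≤ j)
    (hB1 : (B1:ℝ) ≤ Real.exp σ) (hB2 : (B2:ℝ) ≤ Real.exp σ) (A : ℝ) (hA : A = Real.exp 3000)
    (hAj : A + 2 ≤ j) (hAσ : 48 * A * σ ≤ j) (ω : ℝ)
    (hang : ∀ l : Fin (16 * j) × Fin (16 * j), |ω * triLam B1 B2 l| ≤ 48 * j * σ)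
    (p : triIx j → ℤ) (hpb : ∀ i, |(p i : ℝ)| ≤ Real.exp (16164 * (j:ℝ) ^ 3))
    (t0 t1 : ℕ) (ht1 : t1 ≤ 144 * j ^ 2) (z : ℂ) (hz : ‖z‖ = A * j) :
    ‖triG j (fun i => (p i : ℂ)) (fun i => i.1.1) (fun i => (triLam B1 B2 i.2 : ℂ)) (ω : ℂ) t0 t1 z‖ ≤
      Real.exp (214000 * (j:ℝ) ^ 3) := by
  have hA0 : 0 < A := hA ▸ Real.exp_pos _
  have hj1 : (1:ℝ) ≤ j := by exact_mod_cast hj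
  have hu1 : (1:ℝ) ≤ (j:ℝ)^3 := one_le_pow₀ hj1
  have hterm : ∀ i : triIx j, ‖(p i : ℂ) * (Polynomial.hasseDeriv t0 (triQ j i.1)).eval z * (triLam B1 B2 i.2 : ℂ) ^ t1 *
      Complex.exp ((ω : ℂ) * (triLam B1 B2 i.2 : ℂ) * z)‖ ≤ Real.exp (213046 * (j:ℝ) ^ 3) := by
    intro i
    rw [norm_mul, norm_mul, norm_mul, norm_pow, Complex.norm_intCast, Complex.norm_natCast]
    have he : ‖Complex.exp ((ω : ℂ) * (triLam B1 B2 i.2 : ℂ) * z)‖ ≤ Real.exp ((j:ℝ) ^ 3) := by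
      rw [Complex.norm_exp]
      refine Real.exp_le_exp.2 ((Complex.re_le_norm _).trans ?_)
      have : (ω : ℂ) * (triLam B1 B2 i.2 : ℂ) = ((ω * triLam B1 B2 i.2 : ℝ) : ℂ) := by push_cast; rfl
      rw [norm_mul, this, Complex.norm_real, Real.norm_eq_abs, hz]
      calc _ ≤ (48 * j * σ) * (A * j) := by gcongr; exact hang i.2
        _ = (j:ℝ) ^ 2 * (48 * A * σ) := by ring
        _ ≤ (j:ℝ) ^ 2 * j := mul_le_mul_of_nonneg_left hAσ (by positivity)
        _ = _ := by ring
    refine (tri_mul_exp (norm_nonneg _) (tri_mul_exp (by positivity) (tri_mul_exp (norm_nonneg _) (hpb i)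
      (tri_hasse_big j i.1 t0 hj i.1.2.le A hA hAj z hz.le))
      (tri_lam_pow j t1 _ (by positivity) (tri_lam_bound j B1 B2 i.2.1 i.2.2 hj σ (by linarith) hB1 hB2 i.2.1.2 i.2.2.2) ht1)) he).trans
      (Real.exp_le_exp.2 (by linarith))
  unfold triG
  refine (tri_sum_bound j hj _ _ _ hterm (by positivity)).trans ?_
  rw [← Real.exp_add]
  exact Real.exp_le_exp.2 (by linarith)

set_option maxHeartbeats 2000000 in
/-- Core lower bound for linear forms in two logarithms. -/
theorem tri_core (A : ℝ) (hA : A = Real.exp 3000) (j P1 Q1 P2 Q2 B1 B2 : ℕ) (σ : ℝ) (hσ1 : 1 ≤ σ)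
    (hσ : 4096 * σ ≤ j) (hAj : A + 2 ≤ j) (hAσ : 48 * A * σ ≤ j) (hP1 : (P1:ℝ) ≤ Real.exp σ)
    (hQ1 : (Q1:ℝ) ≤ Real.exp σ) (hP2 : (P2:ℝ) ≤ Real.exp σ) (hQ2 : (Q2:ℝ) ≤ Real.exp σ)
    (hB1 : (B1:ℝ) ≤ Real.exp σ) (hB2 : (B2:ℝ) ≤ Real.exp σ)
    (p1 : 1 ≤ P1) (q1 : 1 ≤ Q1) (p2 : 1 ≤ P2) (q2 : 1 ≤ Q2) (b2 : 1 ≤ B2)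
    (η : ℝ) (hη0 : 0 < η) (hη : η ^ 2 * Q1 = P1) (hirr : Irrational η)
    (hinj : Function.Injective (triLam (j := j) B1 B2)) :
    Real.exp (-(64 * A + 100000) * (j:ℝ) ^ 3) < |B2 * Real.log (P2 / Q2) - B1 * Real.log η| := by
  have hA0 : 0 < A := hA ▸ Real.exp_pos _
  have hj1 : (1:ℝ) ≤ j := by linarith
  have hj : 1 ≤ j := by exact_mod_cast hj1
  have hj0 : 0 < j := hj
  have hu1 : (1:ℝ) ≤ (j:ℝ)^3 := one_le_pow₀ hj1
  set u : ℝ := (j:ℝ) ^ 3 with hu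
  by_contra hcon
  push Not at hcon
  set Λ : ℝ := B2 * Real.log (P2 / Q2) - B1 * Real.log η with hΛe
  have hΛ : |Λ| ≤ Real.exp (-100000 * u) := hcon.trans (Real.exp_le_exp.2 (by nlinarith))
  have hΛ1 : |Λ| ≤ 1 := hΛ.trans (Real.exp_le_one_iff.2 (by linarith))
  obtain ⟨hω, hang⟩ := tri_angle j P1 Q1 P2 Q2 B1 B2 σ hσ1 hP1 hQ1 hP2 hQ2 p1 q1 p2 q2 b2 η hη0 hη hΛ1
  obtain ⟨p, hp, hpb, hearly⟩ := tri_siegel_stage j P1 Q1 P2 Q2 B1 B2 hj σ (by linarith) hσ hP1 hQ1 hP2 hQ2 hB1 hB2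
  obtain ⟨y, hy, t0, ht0, t1, ht1, hlate⟩ := tri_late j P1 Q1 P2 Q2 B1 B2 hj σ (by linarith) hσ hP1 hQ1 hP2 hQ2 hB1 hB2
    p1 q1 p2 q2 η hη0.le hη hirr hinj p hp hpb
  have happ := tri_approx j P1 Q1 P2 Q2 B1 B2 hj σ hσ1 hσ hP1 hQ1 hP2 hQ2 hB1 hB2
    p1 q1 p2 q2 b2 η hη0 hη Λ hΛe hΛ p hpb
  have hbig := tri_G_big j B1 B2 hj σ hσ1 hσ hB1 hB2 A hA hAj hAσ (Real.log η / B2) hang p hpb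
  set ω : ℝ := Real.log η / B2 with hωe
  set G := triG j (fun i => (p i : ℂ)) (fun i => i.1.1) (fun i => (triLam B1 B2 i.2 : ℂ)) (ω : ℂ) with hG
  have hν : ((Nat.lcmUpto j : ℕ) : ℝ) ≠ 0 := by exact_mod_cast (Nat.lcmUpto_pos j).ne'
  have hq1 : (Q1 : ℝ) ≠ 0 := by exact_mod_cast (by omega : Q1 ≠ 0)
  have hq2 : (Q2 : ℝ) ≠ 0 := by exact_mod_cast (by omega : Q2 ≠ 0)
  have hE : ∀ q < 5 * j, ∀ a < 17 * j ^ 2, ∀ b < 144 * j ^ 2, ‖G a b ((2 * q : ℕ) : ℂ)‖ ≤ |Λ| * Real.exp (23000 * u) := by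
    intro q hq a ha b hb
    have h1 := happ a b (2 * q) hb.le (by omega)
    have h2 := triX_eq j P1 Q1 P2 Q2 B1 B2 hj p η p1 q1 q2 hη a b (2 * q) (by omega)
    have h3 : (∑ i : triIx j, ((p i * triEnt j P1 Q1 P2 Q2 B1 B2 a b (2 * q) i : ℤ) : ℝ) * η ^ ((i.2.1.1 * (2 * q)) % 2)) = 0 := by
      have h4 := congrArg (fun n : ℤ => (n : ℝ)) (hearly q hq a ha b hb)
      simp only [Int.cast_sum, Int.cast_zero] at h4
      rw [← h4]
      refine Finset.sum_congr rfl fun i _ => ?_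
      rw [show i.2.1.1 * (2 * q) = 2 * (i.2.1.1 * q) by ring, Nat.mul_mod_right, pow_zero, mul_one]
    rw [h3, Complex.ofReal_zero] at h2
    have h5 := (mul_eq_zero.1 h2).resolve_left (by
      exact_mod_cast mul_ne_zero (pow_ne_zero _ hν) (mul_ne_zero (pow_ne_zero _ hq1) (pow_ne_zero _ hq2)))
    rw [h5, sub_zero] at h1
    exact h1
  have hjets : ∀ q < 5 * j, ∀ i < 16 * j ^ 2, ‖iteratedDeriv i (G t0 t1) ((2 * q : ℕ) : ℂ)‖ ≤ |Λ| * Real.exp (23080 * u) := by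
    intro q hq i hi
    have h1 := tri_G_jets j (fun i => (p i : ℂ)) (fun i => i.1.1) (fun i => (triLam B1 B2 i.2 : ℂ)) (ω : ℂ)
      (17 * j ^ 2) (144 * j ^ 2) ((2 * q : ℕ) : ℂ) _ (hE q hq) i t0 t1 (by omega) (by omega)
    refine h1.trans ?_
    have h2 : ((17 * j ^ 2 : ℕ) : ℝ) + ‖(ω : ℂ)‖ ≤ Real.exp (5 * j) := by
      rw [Complex.norm_real, Real.norm_eq_abs]
      have e1 := tri_pow_exp (j:ℝ) j _ 2 (by positivity) (tri_nat_exp j) le_rfl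
      have e2 : (18:ℝ) ≤ Real.exp 3 := by
        have h2 : (2.7:ℝ) ≤ Real.exp 1 := by linarith [Real.exp_one_gt_d9]
        calc (18:ℝ) ≤ 2.7 ^ 3 := by norm_num
          _ ≤ Real.exp 1 ^ 3 := by gcongr
          _ = Real.exp 3 := by rw [← Real.exp_nat_mul]; norm_num
      have e3 := tri_mul_exp (by positivity) e2 e1
      push_cast
      have e4 : |ω| ≤ (j:ℝ) ^ 2 := by nlinarith
      calc (17:ℝ) * (j:ℝ) ^ 2 + |ω| ≤ 18 * (j:ℝ) ^ 2 := by linarith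
        _ ≤ _ := e3
        _ ≤ _ := Real.exp_le_exp.2 (by push_cast; linarith)
    have h3 : (((17 * j ^ 2 : ℕ) : ℝ) + ‖(ω : ℂ)‖) ^ i ≤ Real.exp (80 * u) := by
      refine tri_pow_exp _ _ _ i (by positivity) h2 ?_
      have : (i : ℝ) ≤ 16 * (j:ℝ) ^ 2 := by exact_mod_cast hi.le
      calc (i : ℝ) * (5 * j) ≤ (16 * (j:ℝ) ^ 2) * (5 * j) := by gcongr
        _ = _ := by rw [hu]; ring
    calc _ ≤ Real.exp (80 * u) * (|Λ| * Real.exp (23000 * u)) := by gcongr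
      _ = |Λ| * (Real.exp (80 * u) * Real.exp (23000 * u)) := by ring
      _ = _ := by rw [← Real.exp_add]; ring_nf
  have hA256 : (256:ℝ) ≤ A := by rw [hA]; linarith [Real.add_one_le_exp (3000:ℝ)]
  have hAj0 : 0 < A * j := by positivity
  have c1 : 256 * (j:ℝ) ≤ A * j := mul_le_mul_of_nonneg_right hA256 (by positivity)
  have hGd : Differentiable ℂ (G t0 t1) := by rw [hG]; exact tri_G_diff _ _ _ _ _ _ _
  have hy' : (y:ℝ) ≤ 128 * j := by exact_mod_cast hy.le
  have hbig' : ∀ z : ℂ, ‖z‖ = A * j → ‖G t0 t1 z‖ ≤ Real.exp (214000 * u) :=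
    fun z hz => hbig t0 t1 (by omega) z hz
  have d1 : 4 * ((5 * j : ℕ) : ℝ) ≤ A * j := by push_cast; linarith
  have d2 : 2 * ((5 * j : ℕ) : ℝ) ≤ 128 * j := by push_cast; linarith
  have d3 : (128 * j : ℝ) ≤ A * j := by linarith
  have d4 : 0 ≤ |Λ| * Real.exp (23080 * u) := mul_nonneg (abs_nonneg _) (Real.exp_pos _).le
  have hS := tri_schwarz (G t0 t1) hGd (16 * j ^ 2) (5 * j) (by positivity) (by positivity)
    (|Λ| * Real.exp (23080 * u)) (A * j) (128 * j) (Real.exp (214000 * u)) d4 d1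
    (Real.exp_pos _).le d2 d3 hjets hbig' y hy'
  have hcoef : |Λ| * Real.exp (23080 * u) * Real.exp ((((5 * j : ℕ) : ℝ) + 4 * (A * j)) * ((16 * j ^ 2 : ℕ) : ℝ)) ≤
      Real.exp (-76000 * u) := by
    calc _ ≤ Real.exp (-(64 * A + 100000) * u) * Real.exp (23080 * u) * Real.exp ((((5 * j : ℕ) : ℝ) + 4 * (A * j)) * ((16 * j ^ 2 : ℕ) : ℝ)) := by gcongr
      _ ≤ _ := by
        rw [← Real.exp_add, ← Real.exp_add]
        refine Real.exp_le_exp.2 ?_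
        have : (((5 * j : ℕ) : ℝ) + 4 * (A * j)) * ((16 * j ^ 2 : ℕ) : ℝ) = (80 + 64 * A) * u := by
          rw [hu]; push_cast; ring
        rw [this]; nlinarith
  have hratio : ((128 * j : ℝ) / (A * j / 2)) ^ (16 * j ^ 2 * (5 * j)) ≤ Real.exp (-239520 * u) := by
    have e0 : (128 * j : ℝ) / (A * j / 2) = 256 / A := by field_simp; norm_num
    have e1 : (256:ℝ) / A ≤ Real.exp (-2994) := by
      have h256 : (256:ℝ) ≤ Real.exp 6 := by
        have h2 : (2.7:ℝ) ≤ Real.exp 1 := by linarith [Real.exp_one_gt_d9]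
        calc (256:ℝ) ≤ 2.7 ^ 6 := by norm_num
          _ ≤ Real.exp 1 ^ 6 := by gcongr
          _ = Real.exp 6 := by rw [← Real.exp_nat_mul]; norm_num
      rw [div_le_iff₀ hA0, hA, ← Real.exp_add]
      norm_num
      exact h256
    rw [e0]
    refine tri_pow_exp _ _ _ _ (by positivity) e1 ?_
    push_cast; rw [hu]; exact le_of_eq (by ring)
  have hG1 : ‖G t0 t1 y‖ ≤ Real.exp (-76000 * u) + (Real.exp (214000 * u) + Real.exp (-76000 * u)) * Real.exp (-239520 * u) := by
    refine hS.trans ?_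
    gcongr
  have hXb : ‖triX j p B1 B2 η ((P2:ℝ) / Q2) t0 t1 y‖ ≤ ‖G t0 t1 y‖ + |Λ| * Real.exp (23000 * u) := by
    have := happ t0 t1 y (by omega) hy.le
    have h2 := norm_sub_norm_le (triX j p B1 B2 η ((P2:ℝ) / Q2) t0 t1 y) (G t0 t1 y)
    rw [norm_sub_rev] at h2
    linarith
  have hε : |Λ| * Real.exp (23000 * u) ≤ Real.exp (-25520 * u) := by
    calc _ ≤ Real.exp (-100000 * u) * Real.exp (23000 * u) := by gcongr
      _ ≤ _ := by rw [← Real.exp_add]; exact Real.exp_le_exp.2 (by linarith)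
  have k1 : Real.exp (-76000 * u) ≤ Real.exp (-25520 * u) := Real.exp_le_exp.2 (by linarith)
  have k2 : Real.exp (214000 * u) * Real.exp (-239520 * u) ≤ Real.exp (-25520 * u) := by
    rw [← Real.exp_add]; exact Real.exp_le_exp.2 (by linarith)
  have k3 : Real.exp (-76000 * u) * Real.exp (-239520 * u) ≤ Real.exp (-25520 * u) := by
    rw [← Real.exp_add]; exact Real.exp_le_exp.2 (by linarith)
  have k4 : Real.exp (-21658 * u) ≤ 4 * Real.exp (-25520 * u) := by linarith
  have k5 : Real.exp (-21658 * u) = Real.exp (3862 * u) * Real.exp (-25520 * u) := by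
    rw [← Real.exp_add]; ring_nf
  have k6 : 5 ≤ Real.exp (3862 * u) := by linarith [Real.add_one_le_exp (3862 * u)]
  have k7 := Real.exp_pos (-25520 * u)
  nlinarith

theorem tri_log_gap (x y : ℕ) (hx : 1 ≤ x) (hy : 1 ≤ y) (M : ℝ) (hxM : (x:ℝ) ≤ Real.exp M)
    (hyM : (y:ℝ) ≤ Real.exp M) (h : Real.log x - Real.log y ≠ 0) :
    Real.exp (-M) ≤ |Real.log x - Real.log y| := by
  wlog hlt : y < x generalizing x y
  · have hne : x ≠ y := by rintro rfl; simp at h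
    rw [abs_sub_comm]
    exact this y x hy hx hyM hxM (by rw [← neg_sub]; exact neg_ne_zero.2 h) (by omega)
  have hx0 : (0:ℝ) < x := by exact_mod_cast hx
  have hy0 : (0:ℝ) < y := by exact_mod_cast hy
  have h1 : (y:ℝ) + 1 ≤ x := by exact_mod_cast hlt
  have h2 := Real.log_le_sub_one_of_pos (div_pos hy0 hx0)
  rw [Real.log_div hy0.ne' hx0.ne'] at h2
  have h3 : Real.exp (-M) ≤ 1 / x := by
    rw [Real.exp_neg, ← one_div]; exact one_div_le_one_div_of_le hx0 hxM
  have h4 : (y:ℝ) / x ≤ 1 - 1 / x := by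
    rw [div_le_iff₀ hx0, sub_mul, one_div, inv_mul_cancel₀ hx0.ne']; linarith
  exact le_trans (by linarith) (le_abs_self _)

theorem tri_lin_gap (P1 Q1 P2 Q2 e1 e2 e3 e4 : ℕ) (σ M : ℝ)
    (hP1 : (P1:ℝ) ≤ Real.exp σ)
    (hQ1 : (Q1:ℝ) ≤ Real.exp σ) (hP2 : (P2:ℝ) ≤ Real.exp σ) (hQ2 : (Q2:ℝ) ≤ Real.exp σ)
    (p1 : 1 ≤ P1) (q1 : 1 ≤ Q1) (p2 : 1 ≤ P2) (q2 : 1 ≤ Q2)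
    (hM : ((e1:ℝ) + e2 + e3 + e4) * σ ≤ M)
    (h : ((e1:ℝ) - e2) * Real.log (P2 / Q2) + ((e3:ℝ) - e4) * Real.log (P1 / Q1) ≠ 0) :
    Real.exp (-M) ≤ |((e1:ℝ) - e2) * Real.log (P2 / Q2) + ((e3:ℝ) - e4) * Real.log (P1 / Q1)| := by
  have p1' : (P1:ℝ) ≠ 0 := by exact_mod_cast (by omega : P1 ≠ 0)
  have q1' : (Q1:ℝ) ≠ 0 := by exact_mod_cast (by omega : Q1 ≠ 0)
  have p2' : (P2:ℝ) ≠ 0 := by exact_mod_cast (by omega : P2 ≠ 0)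
  have q2' : (Q2:ℝ) ≠ 0 := by exact_mod_cast (by omega : Q2 ≠ 0)
  have e : ((e1:ℝ) - e2) * Real.log (P2 / Q2) + ((e3:ℝ) - e4) * Real.log (P1 / Q1) =
      Real.log ((P2 ^ e1 * Q2 ^ e2 * P1 ^ e3 * Q1 ^ e4 : ℕ) : ℝ) -
      Real.log ((P2 ^ e2 * Q2 ^ e1 * P1 ^ e4 * Q1 ^ e3 : ℕ) : ℝ) := by
    push_cast
    rw [Real.log_div p1' q1', Real.log_div p2' q2']
    rw [Real.log_mul (by positivity) (by positivity), Real.log_mul (by positivity) (by positivity),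
      Real.log_mul (by positivity) (by positivity), Real.log_mul (by positivity) (by positivity),
      Real.log_mul (by positivity) (by positivity), Real.log_mul (by positivity) (by positivity)]
    simp only [Real.log_pow]
    ring
  rw [e] at h ⊢
  refine tri_log_gap _ _ ?_ ?_ M ?_ ?_ h
  · exact Nat.one_le_iff_ne_zero.2 (by positivity)
  · exact Nat.one_le_iff_ne_zero.2 (by positivity)
  · push_cast
    refine (tri_mul_exp (by positivity) (tri_mul_exp (by positivity) (tri_mul_exp (by positivity)
      (tri_pow_exp _ _ _ e1 (by positivity) hP2 le_rfl) (tri_pow_exp _ _ _ e2 (by positivity) hQ2 le_rfl))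
      (tri_pow_exp _ _ _ e3 (by positivity) hP1 le_rfl))
      (tri_pow_exp _ _ _ e4 (by positivity) hQ1 le_rfl)).trans (Real.exp_le_exp.2 (by linarith))
  · push_cast
    refine (tri_mul_exp (by positivity) (tri_mul_exp (by positivity) (tri_mul_exp (by positivity)
      (tri_pow_exp _ _ _ e2 (by positivity) hP2 le_rfl) (tri_pow_exp _ _ _ e1 (by positivity) hQ2 le_rfl))
      (tri_pow_exp _ _ _ e4 (by positivity) hP1 le_rfl))
      (tri_pow_exp _ _ _ e3 (by positivity) hQ1 le_rfl)).trans (Real.exp_le_exp.2 (by linarith))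

theorem tri_noninj (j P1 Q1 P2 Q2 B1 B2 : ℕ) (σ : ℝ) (hσ1 : 1 ≤ σ)
    (hσ : 4096 * σ ≤ j) (hP1 : (P1:ℝ) ≤ Real.exp σ)
    (hQ1 : (Q1:ℝ) ≤ Real.exp σ) (hP2 : (P2:ℝ) ≤ Real.exp σ) (hQ2 : (Q2:ℝ) ≤ Real.exp σ)
    (p1 : 1 ≤ P1) (q1 : 1 ≤ Q1) (p2 : 1 ≤ P2) (q2 : 1 ≤ Q2) (b1 : 1 ≤ B1) (b2 : 1 ≤ B2)
    (η : ℝ) (hη0 : 0 < η) (hη : η ^ 2 * Q1 = P1)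
    (hinj : ¬ Function.Injective (triLam (j := j) B1 B2))
    (hΛ : B2 * Real.log (P2 / Q2) - B1 * Real.log η ≠ 0) :
    Real.exp (-(100000) * (j:ℝ) ^ 3) ≤ |B2 * Real.log (P2 / Q2) - B1 * Real.log η| := by
  have hj1 : (1:ℝ) ≤ j := by linarith
  have hq1 : (Q1 : ℝ) ≠ 0 := by exact_mod_cast (by omega : Q1 ≠ 0)
  have hB1 : (1:ℝ) ≤ B1 := by exact_mod_cast b1
  have hB2 : (1:ℝ) ≤ B2 := by exact_mod_cast b2
  have hlog : Real.log (P1 / Q1) = 2 * Real.log η := by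
    rw [← hη, mul_div_assoc, div_self hq1, mul_one, Real.log_pow]; norm_num
  rw [Function.not_injective_iff] at hinj
  obtain ⟨⟨l1, l2⟩, ⟨m1, m2⟩, hlam, hne⟩ := hinj
  simp only [triLam] at hlam
  have hlam' : (l1.1:ℝ) * B2 + l2.1 * B1 = m1.1 * B2 + m2.1 * B1 := by exact_mod_cast hlam
  have hl1 : (l1.1:ℝ) ≤ 16 * j := by exact_mod_cast l1.2.le
  have hl2 : (l2.1:ℝ) ≤ 16 * j := by exact_mod_cast l2.2.le
  have hm1 : (m1.1:ℝ) ≤ 16 * j := by exact_mod_cast m1.2.le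
  have hm2 : (m2.1:ℝ) ≤ 16 * j := by exact_mod_cast m2.2.le
  have hd1 : (l1.1:ℝ) - m1.1 ≠ 0 := by
    intro h0
    have h1 : (l1.1:ℝ) = m1.1 := by linarith
    rw [h1] at hlam'
    have h2 : (l2.1:ℝ) = m2.1 := mul_right_cancel₀ (by linarith : (B1:ℝ) ≠ 0) (by linarith)
    apply hne
    rw [Prod.mk.injEq]
    exact ⟨Fin.ext (by exact_mod_cast h1), Fin.ext (by exact_mod_cast h2)⟩
  set T : ℝ := (((2 * l2.1 : ℕ):ℝ) - (2 * m2.1 : ℕ)) * Real.log (P2 / Q2) + ((l1.1:ℝ) - m1.1) * Real.log (P1 / Q1) with hT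
  set Λ : ℝ := B2 * Real.log (P2 / Q2) - B1 * Real.log η with hΛe
  have key : 2 * ((l1.1:ℝ) - m1.1) * Λ = - (B1 * T) := by
    rw [hT, hΛe, hlog]; push_cast
    linear_combination 2 * Real.log (P2 / Q2) * hlam'
  have hT0 : T ≠ 0 := by
    intro h0
    rw [h0, mul_zero, neg_zero] at key
    exact (mul_ne_zero (mul_ne_zero two_ne_zero hd1) hΛ) key
  have hTb := tri_lin_gap P1 Q1 P2 Q2 (2 * l2.1) (2 * m2.1) l1.1 m1.1 σ (96 * j * σ) hP1 hQ1 hP2 hQ2 p1 q1 p2 q2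
    (by push_cast; gcongr; linarith) hT0
  have habs : 2 * |(l1.1:ℝ) - m1.1| * |Λ| = B1 * |T| := by
    have := congrArg abs key
    rw [abs_neg, abs_mul, abs_mul, abs_mul, abs_two, abs_of_pos (by linarith : (0:ℝ) < B1)] at this
    exact this
  have hd : |(l1.1:ℝ) - m1.1| ≤ 16 * j := by
    rw [abs_le]; constructor
    · have : (0:ℝ) ≤ l1.1 := by positivity
      linarith
    · have : (0:ℝ) ≤ m1.1 := by positivity
      linarith
  have h1 : |T| ≤ 32 * j * |Λ| := by
    have a1 : |T| ≤ B1 * |T| := le_mul_of_one_le_left (abs_nonneg _) hB1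
    have a2 : 2 * |(l1.1:ℝ) - m1.1| * |Λ| ≤ 2 * (16 * j) * |Λ| := by gcongr
    linarith
  have h2 : (32:ℝ) * j ≤ Real.exp (32 * j) := by linarith [Real.add_one_le_exp (32 * (j:ℝ))]
  have h3 : Real.exp (-(96 * j * σ)) ≤ Real.exp (32 * j) * |Λ| := 
    (hTb.trans h1).trans (by gcongr)
  have h4 : Real.exp (-(96 * j * σ) - 32 * j) ≤ |Λ| := by
    rw [Real.exp_sub, div_le_iff₀ (Real.exp_pos _)]; linarith
  refine le_trans (Real.exp_le_exp.2 ?_) h4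
  have : (j:ℝ) ≤ (j:ℝ) ^ 3 := le_self_pow₀ hj1 (by norm_num)
  have h5 : (j:ℝ) * σ ≤ (j:ℝ) ^ 3 := by
    calc (j:ℝ) * σ ≤ j * j := by gcongr; linarith
      _ = (j:ℝ)^2 := by ring
      _ ≤ (j:ℝ)^3 := pow_le_pow_right₀ hj1 (by norm_num)
  linarith

theorem tri_root (n : ℕ) : ∀ q : ℚ, 0 < q → q ≠ 1 → q.num.natAbs + q.den ≤ n →
    ∃ (i : ℕ) (r : ℚ), 0 < r ∧ r ≠ 1 ∧ ¬ IsSquare r ∧ q = r ^ (2 ^ i) := by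
  induction n using Nat.strong_induction_on with
  | _ n ih =>
  intro q hq0 hq1 hn
  by_cases hs : IsSquare q
  · obtain ⟨t, ht⟩ := hs
    have ht' : q = |t| * |t| := by rw [abs_mul_abs_self]; exact ht
    have ht0 : t ≠ 0 := by rintro rfl; simp at ht; exact hq0.ne' ht
    have h0 : 0 < |t| := abs_pos.2 ht0
    generalize |t| = w at ht' h0
    have hw1 : w ≠ 1 := by rintro rfl; simp at ht'; exact hq1 ht'
    have hnum : q.num.natAbs = w.num.natAbs * w.num.natAbs := by
      rw [ht', Rat.mul_self_num, Int.natAbs_mul]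
    have hden : q.den = w.den * w.den := by rw [ht', Rat.mul_self_den]
    have a1 : 1 ≤ w.num.natAbs := by
      have := Rat.num_pos.2 h0
      omega
    have a2 : 1 ≤ w.den := w.den_pos
    have a3 : w.num.natAbs ≠ 1 ∨ w.den ≠ 1 := by
      by_contra hcon
      push Not at hcon
      apply hw1
      have := Rat.num_pos.2 h0
      rw [← Rat.num_div_den w, hcon.2, (by omega : w.num = 1)]; norm_num
    have hlt : w.num.natAbs + w.den < n := by
      rw [hnum, hden] at hn
      rcases a3 with a3 | a3
      · have : 2 ≤ w.num.natAbs := by omega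
        nlinarith
      · have : 2 ≤ w.den := by omega
        nlinarith
    obtain ⟨i, r, hr0, hr1, hrs, hr⟩ := ih _ hlt w h0 hw1 le_rfl
    exact ⟨i + 1, r, hr0, hr1, hrs, by rw [ht', hr, ← pow_add]; congr 1; ring⟩
  · exact ⟨0, q, hq0, hq1, hs, by simp⟩

theorem tri_root_nat (P Q : ℕ) (hP : 1 ≤ P) (hQ : 1 ≤ Q) (hPQ : P ≠ Q) :
    ∃ (i P' Q' : ℕ) (η : ℝ), 1 ≤ P' ∧ 1 ≤ Q' ∧ P' ≤ P ∧ Q' ≤ Q ∧ (2 ^ i ≤ P ∨ 2 ^ i ≤ Q) ∧ 0 < η ∧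
      η ^ 2 * Q' = P' ∧ Irrational η ∧ Real.log (P / Q) = 2 * 2 ^ i * Real.log η := by
  have hP0 : (0:ℚ) < P := by exact_mod_cast hP
  have hQ0 : (0:ℚ) < Q := by exact_mod_cast hQ
  obtain ⟨i, r, hr0, hr1, hrs, hr⟩ := tri_root _ ((P:ℚ) / Q) (div_pos hP0 hQ0)
    (by rw [Ne, div_eq_one_iff_eq hQ0.ne']; exact_mod_cast hPQ) le_rfl
  have hrn := Rat.num_pos.2 hr0
  have hi0 : 2 ^ i ≠ 0 := by positivity
  have hnum : r.num.natAbs ^ (2 ^ i) ≤ P := by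
    have h1 : ((P:ℚ)/Q).num = r.num ^ (2 ^ i) := by rw [hr, Rat.num_pow]
    have h2 : ((P:ℚ)/Q).num ∣ (P:ℤ) := by
      have := Rat.num_dvd (P:ℤ) (b := (Q:ℤ)) (by exact_mod_cast (by omega : Q ≠ 0))
      rwa [Rat.divInt_eq_div, Int.cast_natCast, Int.cast_natCast] at this
    rw [h1] at h2
    have := Int.natAbs_dvd_natAbs.2 h2
    rw [Int.natAbs_pow, Int.natAbs_natCast] at this
    exact Nat.le_of_dvd hP this
  have hden : r.den ^ (2 ^ i) ≤ Q := by
    have h1 : ((P:ℚ)/Q).den = r.den ^ (2 ^ i) := by rw [hr, Rat.den_pow]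
    have h2 : (((P:ℚ)/Q).den : ℤ) ∣ (Q:ℤ) := by
      have := Rat.den_dvd (P:ℤ) (Q:ℤ)
      rwa [Rat.divInt_eq_div, Int.cast_natCast, Int.cast_natCast] at this
    rw [h1] at h2
    exact Nat.le_of_dvd hQ (by exact_mod_cast h2)
  have hrR : (0:ℝ) < r := by exact_mod_cast hr0
  have hrd : (r:ℝ) * r.den = r.num.natAbs := by
    have h1 : r * r.den = r.num := Rat.mul_den_eq_num r
    have h2 : (r.num : ℤ) = (r.num.natAbs : ℤ) := by omega
    have h3 : (r.num : ℚ) = ((r.num.natAbs : ℕ) : ℚ) := by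
      rw [← Int.cast_natCast (R := ℚ) r.num.natAbs]; exact congrArg (fun n : ℤ => (n : ℚ)) h2
    have h4 := congrArg (fun x : ℚ => (x : ℝ)) (h1.trans h3)
    simp only [Rat.cast_mul, Rat.cast_natCast] at h4
    exact h4
  refine ⟨i, r.num.natAbs, r.den, √(r:ℝ), by omega, r.den_pos, (Nat.le_self_pow hi0 _).trans hnum,
    (Nat.le_self_pow hi0 _).trans hden, ?_, Real.sqrt_pos.2 hrR, ?_, ?_, ?_⟩
  · by_cases h1 : 2 ≤ r.num.natAbs
    · left
      exact (Nat.lt_two_pow_self).le.trans ((Nat.pow_le_pow_left h1 _).trans hnum)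
    · right
      have h2 : 2 ≤ r.den := by
        by_contra h3
        have := r.den_pos
        apply hr1
        rw [← Rat.num_div_den r, (by omega : r.den = 1), (by omega : r.num = 1)]; norm_num
      exact (Nat.lt_two_pow_self).le.trans ((Nat.pow_le_pow_left h2 _).trans hden)
  · rw [Real.sq_sqrt hrR.le]; exact hrd
  · exact irrational_sqrt_ratCast_iff.2 ⟨hrs, hr0.le⟩
  · have h1 : (P:ℝ) / Q = (r:ℝ) ^ (2 ^ i) := by
      have h4 := congrArg (fun x : ℚ => (x:ℝ)) hr
      simp only [Rat.cast_div, Rat.cast_natCast, Rat.cast_pow] at h4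
      exact h4
    rw [h1, Real.log_pow, Real.log_sqrt hrR.le]; push_cast; ring

theorem tri_two_logs : ∃ K : ℝ, 0 < K ∧ ∀ (P1 Q1 P2 Q2 b1 b2 : ℕ) (σ : ℝ), 1 ≤ σ →
    (P1:ℝ) ≤ Real.exp σ → (Q1:ℝ) ≤ Real.exp σ → (P2:ℝ) ≤ Real.exp σ → (Q2:ℝ) ≤ Real.exp σ →
    (b1:ℝ) ≤ Real.exp σ → (b2:ℝ) ≤ Real.exp σ → 1 ≤ P1 → 1 ≤ Q1 → 1 ≤ P2 → 1 ≤ Q2 → 1 ≤ b1 → 1 ≤ b2 →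
    b2 * Real.log (P2 / Q2) - b1 * Real.log (P1 / Q1) ≠ 0 →
    Real.exp (-K * σ ^ 3) ≤ |b2 * Real.log (P2 / Q2) - b1 * Real.log (P1 / Q1)| := by
  obtain ⟨A, hA⟩ : ∃ A : ℝ, A = Real.exp 3000 := ⟨_, rfl⟩
  have hA0 : 0 < A := hA ▸ Real.exp_pos _
  set c : ℝ := 4096 + 48 * A + A + 2 with hc
  refine ⟨(64 * A + 100000) * (27 * (c + 1) ^ 3), by positivity, ?_⟩
  intro P1 Q1 P2 Q2 b1 b2 σ hσ1 hP1 hQ1 hP2 hQ2 hb1 hb2 p1 q1 p2 q2 hb1' hb2' hΛ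
  have hτ1 : (1:ℝ) ≤ 3 * σ := by linarith
  have hστ : Real.exp σ ≤ Real.exp (3 * σ) := Real.exp_le_exp.2 (by linarith)
  set j : ℕ := ⌈c * (3 * σ)⌉₊ with hj
  have hjl : c * (3 * σ) ≤ j := Nat.le_ceil _
  have hju : (j:ℝ) ≤ (c + 1) * (3 * σ) := by
    have := (Nat.ceil_lt_add_one (by positivity : 0 ≤ c * (3 * σ))).le
    rw [← hj] at this
    linarith
  have hAτ : 0 < A * (3 * σ) := by positivity
  have hAτ' : A ≤ A * (3 * σ) := le_mul_of_one_le_right hA0.le hτ1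
  have hcτ : c * (3 * σ) = 4096 * (3 * σ) + 48 * A * (3 * σ) + A * (3 * σ) + 2 * (3 * σ) := by rw [hc]; ring
  have hj3 : (j:ℝ) ^ 3 ≤ 27 * (c + 1) ^ 3 * σ ^ 3 := by
    calc (j:ℝ) ^ 3 ≤ ((c + 1) * (3 * σ)) ^ 3 := by gcongr
      _ = _ := by ring
  have hj1 : (1:ℝ) ≤ j := by nlinarith
  have hfin : Real.exp (-((64 * A + 100000) * (27 * (c + 1) ^ 3)) * σ ^ 3) ≤
      Real.exp (-(64 * A + 100000) * (j:ℝ) ^ 3) := by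
    refine Real.exp_le_exp.2 ?_
    have := mul_le_mul_of_nonneg_left hj3 (by positivity : 0 ≤ 64 * A + 100000)
    linarith
  refine hfin.trans ?_
  have hu1 : (1:ℝ) ≤ (j:ℝ)^3 := one_le_pow₀ hj1
  have hAu : 0 ≤ A * (j:ℝ)^3 := by positivity
  by_cases hPQ : P1 = Q1
  · have hq : (Q1:ℝ) ≠ 0 := by exact_mod_cast (by omega : Q1 ≠ 0)
    rw [hPQ, div_self hq, Real.log_one, mul_zero, sub_zero] at hΛ ⊢
    have hp2' : (P2:ℝ) ≠ 0 := by exact_mod_cast (by omega : P2 ≠ 0)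
    have hq2' : (Q2:ℝ) ≠ 0 := by exact_mod_cast (by omega : Q2 ≠ 0)
    have h1 := tri_log_gap P2 Q2 p2 q2 σ hP2 hQ2 (by
      rw [← Real.log_div hp2' hq2']; exact right_ne_zero_of_mul hΛ)
    rw [← Real.log_div hp2' hq2'] at h1
    have h2 : (1:ℝ) ≤ b2 := by exact_mod_cast hb2'
    rw [abs_mul, Nat.abs_cast]
    have h3 : |Real.log (P2 / Q2)| ≤ b2 * |Real.log (P2 / Q2)| := le_mul_of_one_le_left (abs_nonneg _) h2
    refine le_trans (Real.exp_le_exp.2 ?_) (h1.trans h3)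
    have h4 : (j:ℝ) ≤ (j:ℝ) ^ 3 := le_self_pow₀ hj1 (by norm_num)
    linarith
  · obtain ⟨i, P', Q', η, hp', hq', hP', hQ', hi, hη0, hη, hirr, hlog⟩ := tri_root_nat P1 Q1 p1 q1 hPQ
    have hi' : ((2:ℝ) ^ i) ≤ Real.exp σ := by
      rcases hi with hi | hi
      · exact le_trans (by exact_mod_cast hi) hP1
      · exact le_trans (by exact_mod_cast hi) hQ1
    have h2 : (2:ℝ) ≤ Real.exp 1 := by linarith [Real.exp_one_gt_d9]
    have hB1 : ((2 * 2 ^ i * b1 : ℕ) : ℝ) ≤ Real.exp (3 * σ) := by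
      push_cast
      refine (tri_mul_exp (by positivity) (tri_mul_exp (by positivity) h2 hi') hb1).trans
        (Real.exp_le_exp.2 (by linarith))
    have hP'' : (P':ℝ) ≤ Real.exp (3 * σ) := le_trans (by exact_mod_cast hP') (hP1.trans hστ)
    have hQ'' : (Q':ℝ) ≤ Real.exp (3 * σ) := le_trans (by exact_mod_cast hQ') (hQ1.trans hστ)
    have e : b2 * Real.log (P2 / Q2) - b1 * Real.log (P1 / Q1) =
      b2 * Real.log (P2 / Q2) - (2 * 2 ^ i * b1 : ℕ) * Real.log η := by
      rw [hlog]; push_cast; ring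
    rw [e] at hΛ ⊢
    have hB1p : 1 ≤ 2 * 2 ^ i * b1 := Nat.one_le_iff_ne_zero.2 (by positivity)
    by_cases hinj : Function.Injective (triLam (j := j) (2 * 2 ^ i * b1) b2)
    · exact (tri_core A hA j P' Q' P2 Q2 _ b2 (3 * σ) hτ1 (by linarith) (by linarith) (by linarith)
        hP'' hQ'' (hP2.trans hστ) (hQ2.trans hστ) hB1 (hb2.trans hστ) hp' hq' p2 q2 hb2' η hη0 hη hirr hinj).le
    · refine le_trans (Real.exp_le_exp.2 ?_) (tri_noninj j P' Q' P2 Q2 _ b2 (3 * σ) hτ1 (by linarith)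
        hP'' hQ'' (hP2.trans hστ) (hQ2.trans hστ) hp' hq' p2 q2 hB1p hb2' η hη0 hη hinj hΛ)
      linarith

theorem tri_exp_gap (x y ε : ℝ) (hx : 0 < x) (hy : 1 ≤ y) (hε : 0 < ε) (hε1 : ε ≤ 1)
    (h : ε ≤ |Real.log x - Real.log y|) : ε / 2 ≤ |x - y| := by
  have hy0 : 0 < y := by linarith
  rcases le_abs.1 h with h | h
  · have h1 : Real.log y + ε ≤ Real.log x := by linarith
    have h2 := Real.exp_le_exp.2 h1
    rw [Real.exp_add, Real.exp_log hx, Real.exp_log hy0] at h2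
    have h3 := Real.add_one_le_exp ε
    have h4 : y * (ε + 1) ≤ y * Real.exp ε := by gcongr
    refine le_trans ?_ (le_abs_self _)
    nlinarith
  · have h1 : Real.log x + ε ≤ Real.log y := by linarith
    have h2 := Real.exp_le_exp.2 h1
    rw [Real.exp_add, Real.exp_log hx, Real.exp_log hy0] at h2
    have h3 := Real.add_one_le_exp ε
    have h4 : x * (ε + 1) ≤ x * Real.exp ε := by gcongr
    refine le_trans ?_ (neg_le_abs _)
    by_contra hcon
    push Not at hcon
    nlinarith

theorem tri_final (a b c : ℤ) (β γ : ℕ) (m : ℝ) (hβ : 1 ≤ β) (hβγ : β < γ) (ha : a ≠ 0) (hb : b ≠ 0) (hc : c ≠ 0)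
    (hm : 0 < m) (hd : (b:ℝ) * β * m ^ β + c * γ * m ^ γ = 0) :
    0 < |(b:ℝ) * m ^ β + c * m ^ γ| ∧
    ((γ - β : ℕ) : ℝ) * (Real.log |(b:ℝ) * m ^ β + c * m ^ γ| - Real.log |(a:ℝ)|) =
    ((γ - β : ℕ) : ℝ) * Real.log (((b.natAbs * (γ - β) : ℕ) : ℝ) / ((γ * a.natAbs : ℕ) : ℝ)) -
      β * Real.log (((c.natAbs * γ : ℕ) : ℝ) / ((b.natAbs * β : ℕ) : ℝ)) := by
  have ha' : 0 < |(a:ℝ)| := abs_pos.2 (by exact_mod_cast ha)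
  have hb' : 0 < |(b:ℝ)| := abs_pos.2 (by exact_mod_cast hb)
  have hc' : 0 < |(c:ℝ)| := abs_pos.2 (by exact_mod_cast hc)
  have hβ0 : (0:ℝ) < β := by exact_mod_cast hβ
  have hγ0 : (0:ℝ) < γ := by exact_mod_cast (by omega : 0 < γ)
  obtain ⟨D, hD0, hDe⟩ : ∃ D : ℝ, 0 < D ∧ ((γ - β : ℕ) : ℝ) = D := ⟨_, by exact_mod_cast (by omega : 0 < γ - β), rfl⟩
  have hDe' : D = γ - β := by rw [← hDe, Nat.cast_sub hβγ.le]
  have e1 : |(b:ℝ)| * β * m ^ β = |(c:ℝ)| * γ * m ^ γ := by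
    have : (b:ℝ) * β * m ^ β = - (c * γ * m ^ γ) := by linarith
    have := congrArg abs this
    rwa [abs_neg, abs_mul, abs_mul, abs_mul, abs_mul, abs_of_pos hβ0, abs_of_pos hγ0,
      abs_of_pos (pow_pos hm _), abs_of_pos (pow_pos hm _)] at this
  have e2 : |(b:ℝ) * m ^ β + c * m ^ γ| * γ = |(b:ℝ)| * m ^ β * D := by
    have : ((b:ℝ) * m ^ β + c * m ^ γ) * γ = b * m ^ β * D := by rw [hDe']; linarith
    have := congrArg abs this
    rwa [abs_mul, abs_mul, abs_mul, abs_of_pos hD0, abs_of_pos hγ0, abs_of_pos (pow_pos hm _)] at this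
  have hX : 0 < |(b:ℝ) * m ^ β + c * m ^ γ| := by
    have : 0 < |(b:ℝ)| * m ^ β * D := by positivity
    rw [← e2] at this
    exact pos_of_mul_pos_left this hγ0.le
  refine ⟨hX, ?_⟩
  have hmb := pow_pos hm β
  have hmg := pow_pos hm γ
  have l1 := congrArg Real.log e1
  have l2 := congrArg Real.log e2
  generalize |(b:ℝ) * m ^ β + c * m ^ γ| = X at hX l2 ⊢
  rw [Real.log_mul (by positivity) hmb.ne', Real.log_mul hb'.ne' hβ0.ne', Real.log_mul (by positivity) hmg.ne',
    Real.log_mul hc'.ne' hγ0.ne', Real.log_pow, Real.log_pow] at l1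
  rw [Real.log_mul hX.ne' hγ0.ne', Real.log_mul (by positivity) hD0.ne', Real.log_mul hb'.ne' hmb.ne', Real.log_pow] at l2
  rw [Nat.cast_mul, Nat.cast_mul, Nat.cast_mul, Nat.cast_mul, Nat.cast_natAbs, Nat.cast_natAbs, Nat.cast_natAbs,
    Int.cast_abs, Int.cast_abs, Int.cast_abs, hDe,
    Real.log_div (by positivity) (by positivity), Real.log_div (by positivity) (by positivity),
    Real.log_mul hb'.ne' hD0.ne', Real.log_mul hγ0.ne' ha'.ne', Real.log_mul hc'.ne' hγ0.ne', Real.log_mul hb'.ne' hβ0.ne']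
  have l3 : D * Real.log m = Real.log |(b:ℝ)| + Real.log β - Real.log |(c:ℝ)| - Real.log γ := by
    rw [hDe']; linarith
  linear_combination D * l2 + β * l3

/-- Lemma 6 of the paper: lower bound on the value of a trinomial at a positive
critical point. -/
theorem trinomial_critical_value_lower_bound :
    ∃ C₂ : ℝ, 0 < C₂ ∧
      ∀ (a b c : ℤ) (β γ : ℕ) (s : ℝ)
        (f : ℝ → ℝ),
        1 ≤ β → β < γ → a ≠ 0 → 1 ≤ s →
        f = (fun x => (a : ℝ) + (b : ℝ) * x ^ β + (c : ℝ) * x ^ γ) →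
        Real.log (max (max (max |(a : ℝ)| |(b : ℝ)|) |(c : ℝ)|) (max (β : ℝ) (γ : ℝ))) ≤ s →
        ∀ m : ℝ, 0 < m → deriv f m = 0 → f m ≠ 0 →
          |f m| ≥ Real.exp (-C₂ * s ^ 3) := by
  obtain ⟨K, hK, hlogs⟩ := tri_two_logs
  refine ⟨8 * K + 2, by positivity, ?_⟩
  intro a b c β γ s f hβ hβγ ha hs hf hlog m hm hder hfm
  have hs3 : s ≤ s ^ 3 := le_self_pow₀ hs (by norm_num)
  have hKs : 0 ≤ K * s ^ 3 := by positivity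
  have hβ0 : (0:ℝ) < β := by exact_mod_cast hβ
  have hγ0 : (0:ℝ) < γ := by exact_mod_cast (by omega : 0 < γ)
  have ha1 : (1:ℝ) ≤ |(a:ℝ)| := by exact_mod_cast Int.one_le_abs ha
  have hexp1 : Real.exp (-(8 * K + 2) * s ^ 3) ≤ 1 := Real.exp_le_one_iff.2 (by nlinarith)
  have hmax : max (max (max |(a : ℝ)| |(b : ℝ)|) |(c : ℝ)|) (max (β : ℝ) (γ : ℝ)) ≤ Real.exp s :=
    (Real.log_le_iff_le_exp (lt_of_lt_of_le hβ0 ((le_max_left _ _).trans (le_max_right _ _)))).1 hlog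
  simp only [max_le_iff] at hmax
  obtain ⟨⟨⟨hA, hB⟩, hC⟩, hBe, hGa⟩ := hmax
  have hd : (b:ℝ) * β * m ^ β + c * γ * m ^ γ = 0 := by
    have h1 : HasDerivAt f ((b:ℝ) * (β * m ^ (β - 1)) + c * (γ * m ^ (γ - 1))) m := by
      rw [hf]
      exact (((hasDerivAt_pow β m).const_mul (b:ℝ)).const_add (a:ℝ)).add ((hasDerivAt_pow γ m).const_mul (c:ℝ))
    rw [h1.deriv] at hder
    have e1 : m ^ β = m ^ (β - 1) * m := by rw [← pow_succ]; congr 1; omega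
    have e2 : m ^ γ = m ^ (γ - 1) * m := by rw [← pow_succ]; congr 1; omega
    rw [e1, e2]
    linear_combination m * hder
  have hfm' : f m = a + ((b:ℝ) * m ^ β + c * m ^ γ) := by rw [hf]; ring
  have hmb := (pow_pos hm β).ne'
  have hmg := (pow_pos hm γ).ne'
  by_cases hb : b = 0
  · have hc : (c:ℝ) = 0 := by
      rw [hb] at hd
      simpa [hγ0.ne', hmg] using hd
    rw [hfm', hb, hc]
    simp only [Int.cast_zero, zero_mul, add_zero]
    exact hexp1.trans ha1
  by_cases hc : c = 0
  · exfalso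
    rw [hc] at hd
    have : (b:ℝ) ≠ 0 := by exact_mod_cast hb
    simp [hβ0.ne', hmb, this] at hd
  obtain ⟨hX, hkey⟩ := tri_final a b c β γ m hβ hβγ ha hb hc hm hd
  set X : ℝ := (b:ℝ) * m ^ β + c * m ^ γ with hXe
  have hDpos : 1 ≤ γ - β := by omega
  have hD1 : (1:ℝ) ≤ ((γ - β : ℕ) : ℝ) := by exact_mod_cast hDpos
  have hDs : ((γ - β : ℕ) : ℝ) ≤ Real.exp s := le_trans (by exact_mod_cast Nat.sub_le γ β) hGa
  have na : ((a.natAbs : ℕ) : ℝ) ≤ Real.exp s := by rw [Nat.cast_natAbs, Int.cast_abs]; exact hA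
  have nb : ((b.natAbs : ℕ) : ℝ) ≤ Real.exp s := by rw [Nat.cast_natAbs, Int.cast_abs]; exact hB
  have nc : ((c.natAbs : ℕ) : ℝ) ≤ Real.exp s := by rw [Nat.cast_natAbs, Int.cast_abs]; exact hC
  have pa : 1 ≤ a.natAbs := Int.natAbs_pos.2 ha
  have pb : 1 ≤ b.natAbs := Int.natAbs_pos.2 hb
  have pc : 1 ≤ c.natAbs := Int.natAbs_pos.2 hc
  have pg : 1 ≤ γ := by omega
  have h2s : Real.exp s ≤ Real.exp (2 * s) := Real.exp_le_exp.2 (by linarith)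
  have prod : ∀ x y : ℕ, (x:ℝ) ≤ Real.exp s → (y:ℝ) ≤ Real.exp s → ((x * y : ℕ) : ℝ) ≤ Real.exp (2 * s) := by
    intro x y hx hy
    rw [Nat.cast_mul, two_mul]
    exact tri_mul_exp (by positivity) hx hy
  rw [hfm'] at hfm ⊢
  by_cases hδ : Real.log |X| - Real.log |(a:ℝ)| = 0
  · have h1 : |X| = |(a:ℝ)| := Real.log_injOn_pos (Set.mem_Ioi.2 hX) (Set.mem_Ioi.2 (by linarith)) (by linarith)
    rcases abs_eq_abs.1 h1 with h2 | h2
    · rw [h2, ← two_mul, abs_mul, abs_two]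
      linarith
    · exact absurd (by rw [h2]; ring) hfm
  · have hΛ := hlogs (c.natAbs * γ) (b.natAbs * β) (b.natAbs * (γ - β)) (γ * a.natAbs) β (γ - β) (2 * s)
      (by linarith) (prod _ _ nc hGa) (prod _ _ nb hBe) (prod _ _ nb hDs) (prod _ _ hGa na)
      (hBe.trans h2s) (hDs.trans h2s) (Nat.mul_pos pc pg) (Nat.mul_pos pb hβ) (Nat.mul_pos pb hDpos)
      (Nat.mul_pos pg pa) hβ hDpos (by rw [← hkey]; exact mul_ne_zero (by linarith) hδ)
    rw [← hkey, abs_mul, Nat.abs_cast] at hΛ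
    set δ := Real.log |X| - Real.log |(a:ℝ)| with hδe
    have h1 : Real.exp (-K * (2 * s) ^ 3 - s) ≤ |δ| := by
      rw [Real.exp_sub, div_le_iff₀ (Real.exp_pos _)]
      refine hΛ.trans ?_
      rw [mul_comm]
      gcongr
    have e8 : -K * (2 * s) ^ 3 - s = -8 * (K * s ^ 3) - s := by ring
    rw [e8] at h1
    have h2 := tri_exp_gap |X| |(a:ℝ)| _ hX ha1 (Real.exp_pos _) (Real.exp_le_one_iff.2 (by linarith)) h1
    have h3 : |(|X| - |(a:ℝ)|)| ≤ |(a:ℝ) + X| := by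
      have := abs_abs_sub_abs_le_abs_sub X (-(a:ℝ))
      rw [abs_neg, sub_neg_eq_add, add_comm X] at this
      exact this
    refine le_trans ?_ (h2.trans h3)
    have h4 : (2:ℝ) ≤ Real.exp 1 := by linarith [Real.exp_one_gt_d9]
    have h5 : Real.exp (-(8 * K + 2) * s ^ 3) * Real.exp 1 ≤ Real.exp (-8 * (K * s ^ 3) - s) := by
      rw [← Real.exp_add]; exact Real.exp_le_exp.2 (by linarith)
    have h6 := mul_le_mul_of_nonneg_left h4 (Real.exp_pos (-(8 * K + 2) * s ^ 3)).le
    linarith
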